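/- arXiv:math/0607555 — 3 statements merged into one kernel-verified Lean document; each statement's English description precedes it below -/
import Mathlib

section
/- For every ρ ∈ ℂ the system dW/dx = ρA(x)W has a fundamental solution whose entries are meromorphic on all of ℂ if and only if r''(x_k) = 0 at every zero x_k of r and q''(y_ℓ) = 0 at every pole y_ℓ of r, where q = 1/r. -/
open Filter Topology Metric

theorem exists_eventually_hasDerivAt_linear {E : Type*} [NormedAddCommGroup E] [NormedSpace ℂ E]
    [CompleteSpace E] {B : ℂ → E →L[ℂ] E} {z : ℂ} (hB : AnalyticAt ℂ B z) (v₀ : E) :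
    ∃ v : ℂ → E, v z = v₀ ∧ ∀ᶠ x in 𝓝 z, HasDerivAt v (B x (v x)) x := by
  obtain ⟨M, hM, hBM⟩ : ∃ M > 0, ∀ᶠ x in 𝓝 z, ‖B x‖ ≤ M :=
    ⟨‖B z‖ + 1, by positivity, (hB.continuousAt.norm.eventually_lt continuousAt_const
      (lt_add_one _)).mono fun x hx => hx.le⟩
  obtain ⟨ε, hε, hball⟩ := Metric.eventually_nhds_iff_ball.1
    (hBM.and (hB.eventually_analyticAt.mono fun x hx => hx.differentiableAt))
  obtain ⟨R, hR, hRε, hMR⟩ : ∃ R > 0, R ≤ ε ∧ M * R ≤ 1 / 2 := by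
    refine ⟨min ε (1 / (2 * M)), by positivity, min_le_left _ _, ?_⟩
    calc M * min ε (1 / (2 * M)) ≤ M * (1 / (2 * M)) := by gcongr; exact min_le_right _ _
      _ = 1 / 2 := by field_simp
  have hBR : ∀ x ∈ ball z R, ‖B x‖ ≤ M := fun x hx => (hball x (ball_subset_ball hRε hx)).1
  have hBd : DifferentiableOn ℂ B (ball z R) := fun x hx =>
    (hball x (ball_subset_ball hRε hx)).2.differentiableWithinAt
  have hprim : ∀ f : ℂ → E, DifferentiableOn ℂ f (ball z R) →
      ∃ g : ℂ → E, g z = 0 ∧ ∀ x ∈ ball z R, HasDerivAt g (B x (f x)) x := fun f hf =>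
    (hBd.clm_apply hf).isExactOn_ball.with_val_at z 0
  choose! T hT₀ hT using hprim
  let F : ℕ → ℂ → E := fun n => T^[n] fun _ => v₀
  have hFs : ∀ n, F (n + 1) = T (F n) := fun n => Function.iterate_succ_apply' _ _ _
  have hFd : ∀ n, DifferentiableOn ℂ (F n) (ball z R) := by
    intro n
    induction n with
    | zero => exact differentiableOn_const _
    | succ n ih =>
      rw [hFs]
      exact fun x hx => (hT _ ih x hx).differentiableAt.differentiableWithinAt
  have hFb : ∀ n, ∀ x ∈ ball z R, ‖F n x‖ ≤ ‖v₀‖ * (1 / 2) ^ n := by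
    intro n
    induction n with
    | zero => intro x _; simp [F]
    | succ n ih =>
      intro x hx
      have h := (convex_ball z R).norm_image_sub_le_of_norm_hasDerivWithin_le
        (f := F (n + 1)) (f' := fun x => B x (F n x)) (C := M * (‖v₀‖ * (1 / 2) ^ n))
        (fun y hy => by rw [hFs]; exact (hT _ (hFd n) y hy).hasDerivWithinAt)
        (fun y hy => (ContinuousLinearMap.le_opNorm _ _).trans
          (mul_le_mul (hBR y hy) (ih y hy) (norm_nonneg _) hM.le)) (mem_ball_self hR) hx
      have h0 : F (n + 1) z = 0 := by rw [hFs]; exact hT₀ _ (hFd n)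
      rw [h0, sub_zero] at h
      have hxR : ‖x - z‖ ≤ R := (mem_ball_iff_norm.1 hx).le
      calc ‖F (n + 1) x‖ ≤ M * (‖v₀‖ * (1 / 2) ^ n) * ‖x - z‖ := h
        _ ≤ M * (‖v₀‖ * (1 / 2) ^ n) * R := by gcongr
        _ = M * R * (‖v₀‖ * (1 / 2) ^ n) := by ring
        _ ≤ 1 / 2 * (‖v₀‖ * (1 / 2) ^ n) := by gcongr
        _ = ‖v₀‖ * (1 / 2) ^ (n + 1) := by ring
  have hu : Summable fun n : ℕ => ‖v₀‖ * (1 / 2 : ℝ) ^ n := summable_geometric_two.mul_left _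
  refine ⟨fun x => ∑' n, F n x, ?_, ?_⟩
  · show ∑' n, F n z = v₀
    rw [tsum_eq_single 0]
    · rfl
    · rintro (_ | n) hn
      · exact absurd rfl hn
      · rw [hFs]; exact hT₀ _ (hFd n)
  · filter_upwards [ball_mem_nhds z hR] with x hx
    have hd := Complex.differentiableOn_tsum_of_summable_norm hu hFd isOpen_ball hFb
    have hs := Complex.hasSum_deriv_of_summable_norm hu hFd isOpen_ball hFb hx
    have hs' : HasSum (fun n => F n x) (∑' n, F n x) :=
      (Summable.of_norm_bounded hu fun n => hFb n x hx).hasSum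
    have h1 : HasSum (fun n => deriv (F (n + 1)) x) (B x (∑' n, F n x)) := by
      have := (B x).hasSum hs'
      refine this.congr_fun fun n => ?_
      rw [hFs, (hT _ (hFd n) x hx).deriv]
    have h2 := (hasSum_nat_add_iff' 1).2 hs
    have h3 : deriv (F 0) x = 0 := deriv_const x v₀
    rw [Finset.sum_range_one, h3, sub_zero] at h2
    rw [← h2.unique h1]
    exact (hd.differentiableAt (isOpen_ball.mem_nhds hx)).hasDerivAt

theorem MeromorphicAt.eventually_eq_const_of_deriv_eq_zero {c : ℂ → ℂ} {x : ℂ}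
    (hc : MeromorphicAt c x) (h : ∀ᶠ y in 𝓝[≠] x, deriv c y = 0) :
    ∃ L, ∀ᶠ y in 𝓝[≠] x, c y = L := by
  have key : ∀ f : ℂ → ℂ, (∀ᶠ y in 𝓝[≠] x, deriv f y = 0) →
      meromorphicOrderAt f x = 0 ∨ meromorphicOrderAt f x = ⊤ := by
    intro f hf
    rcases eq_or_ne (meromorphicOrderAt f x) ⊤ with ht | ht
    · exact .inr ht
    obtain ⟨n, hn⟩ := WithTop.ne_top_iff_exists.1 ht
    by_cases h0 : n = 0
    · left; rw [← hn, h0]; rfl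
    have := meromorphicOrderAt_deriv_eq_sub_one (by exact_mod_cast h0) hn.symm
    rw [meromorphicOrderAt_eq_top_iff.2 hf] at this
    exact absurd this.symm WithTop.coe_ne_top
  rcases key c h with h0 | ht
  · obtain ⟨L, -, hL⟩ := tendsto_ne_zero_of_meromorphicOrderAt_eq_zero hc h0
    refine ⟨L, ?_⟩
    have hm : MeromorphicAt (fun y => c y - L) x := hc.sub (.const L x)
    have hpos : 0 < meromorphicOrderAt (fun y => c y - L) x :=
      (tendsto_zero_iff_meromorphicOrderAt_pos hm).1 (by simpa using hL.sub_const L)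
    rcases key (fun y => c y - L) (by simpa using h) with h1 | h1
    · exact absurd h1 hpos.ne'
    · exact (meromorphicOrderAt_eq_top_iff.1 h1).mono fun y hy => sub_eq_zero.1 hy
  · exact ⟨0, meromorphicOrderAt_eq_top_iff.1 ht⟩

theorem MeromorphicOn.exists_eq_const_of_hasDerivAt_zero {c : ℂ → ℂ} {U S : Set ℂ}
    (hU : IsOpen U) (hUc : IsPreconnected U) (hS : ∀ x ∈ U, ∀ᶠ y in 𝓝[≠] x, y ∉ S)
    (hc : MeromorphicOn c U) (h : ∀ x ∈ U, x ∉ S → HasDerivAt c 0 x) :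
    ∃ L, ∀ x ∈ U, x ∉ S → c x = L := by
  have hloc : ∀ x ∈ U, ∃ L, ∀ᶠ y in 𝓝[≠] x, c y = L := fun x hx =>
    (hc x hx).eventually_eq_const_of_deriv_eq_zero <| by
      filter_upwards [hS x hx, mem_nhdsWithin_of_mem_nhds (hU.mem_nhds hx)] with y hy hyU
      exact (h y hyU hy).deriv
  choose! l hl using hloc
  have hll : ∀ x ∈ U, l =ᶠ[𝓝 x] fun _ => l x := by
    intro x hx
    have := eventually_eventually_nhdsWithin.2 (hl x hx)
    rw [eventually_nhdsWithin_iff] at this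
    filter_upwards [this, hU.mem_nhds hx] with y hy hyU
    rcases eq_or_ne y x with rfl | hyx
    · rfl
    have h1 : ∀ᶠ w in 𝓝[≠] y, c w = l x := by
      have := hy hyx
      rw [nhdsWithin_eq_nhds.2 (isOpen_compl_singleton.mem_nhds hyx)] at this
      exact this.filter_mono nhdsWithin_le_nhds
    obtain ⟨w, hw1, hw2⟩ := (h1.and (hl y hyU)).exists
    exact hw2.symm.trans hw1
  obtain ⟨L, hL⟩ := hU.exists_is_const_of_deriv_eq_zero (f := l) hUc
    (fun x hx => ((hasDerivAt_const x (l x)).congr_of_eventuallyEq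
      (hll x hx)).differentiableAt.differentiableWithinAt)
    (fun x hx => ((hasDerivAt_const x (l x)).congr_of_eventuallyEq (hll x hx)).deriv)
  refine ⟨L, fun x hx hxS => ?_⟩
  rw [← hL x hx]
  exact tendsto_nhds_unique (((h x hx hxS).continuousAt.tendsto).mono_left nhdsWithin_le_nhds)
    (tendsto_const_nhds.congr' ((hl x hx).mono fun y hy => hy.symm))

/-- `W` is a fundamental solution at `x` of the linear system `W' = B W`. -/
def IsFundamentalAt {n : Type*} [Fintype n] [DecidableEq n] (B W : ℂ → Matrix n n ℂ) (x : ℂ) :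
    Prop :=
  (∀ i j, HasDerivAt (fun y => W y i j) ((B x * W x) i j) x) ∧ (W x).det ≠ 0

theorem exists_isFundamentalAt_of_analyticAt {n : Type*} [Fintype n] [DecidableEq n]
    {B : ℂ → Matrix n n ℂ} {z : ℂ} (hB : ∀ i j, AnalyticAt ℂ (fun x => B x i j) z) :
    ∃ W : ℂ → Matrix n n ℂ, ∀ᶠ x in 𝓝 z, IsFundamentalAt B W x := by
  let B' : ℂ → (n → ℂ) →L[ℂ] (n → ℂ) := fun x => ∑ i, ∑ j,
    B x i j • (Matrix.toLin' (Matrix.single i j (1 : ℂ))).toContinuousLinearMap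
  have hB' : AnalyticAt ℂ B' z := by
    refine Finset.analyticAt_fun_sum _ fun i _ => Finset.analyticAt_fun_sum _ fun j _ => ?_
    exact (hB i j).smul analyticAt_const
  have hBv : ∀ x v, B' x v = (B x).mulVec v := by
    intro x v
    conv_rhs => rw [Matrix.matrix_eq_sum_single (B x)]
    simp only [B', sum_apply, Matrix.sum_mulVec, smul_apply, LinearMap.coe_toContinuousLinearMap',
      Matrix.toLin'_apply, ← Matrix.smul_mulVec, Matrix.smul_single, smul_eq_mul, mul_one]
  choose v hv₀ hv using fun j => exists_eventually_hasDerivAt_linear hB' (Pi.single j (1 : ℂ))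
  have hv' := eventually_all.2 hv
  have hderiv : ∀ᶠ x in 𝓝 z, ∀ i j, HasDerivAt (fun y => v j y i)
      ((B x * Matrix.of fun i j => v j x i) i j) x := by
    filter_upwards [hv'] with x hx i j
    have := hasDerivAt_pi.1 (hx j) i
    rwa [hBv] at this
  refine ⟨fun x => Matrix.of fun i j => v j x i, ?_⟩
  have hc : ContinuousAt (fun x => (Matrix.of fun i j => v j x i).det) z := by
    refine (continuous_id.matrix_det).continuousAt.comp
      (continuousAt_pi.2 fun i => continuousAt_pi.2 fun j => ?_)
    exact (hderiv.self_of_nhds i j).continuousAt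
  have h1 : (Matrix.of fun i j => v j z i).det ≠ 0 := by
    have : (Matrix.of fun i j => v j z i) = 1 := by
      ext i j
      simp [hv₀, Matrix.one_apply, Pi.single_apply]
    rw [this, Matrix.det_one]
    exact one_ne_zero
  exact hderiv.and (hc.eventually_ne h1)

theorem IsFundamentalAt.fin_two {B W : ℂ → Matrix (Fin 2) (Fin 2) ℂ} {x : ℂ} :
    IsFundamentalAt B W x ↔
      (∀ j, HasDerivAt (fun y => W y 0 j) (B x 0 0 * W x 0 j + B x 0 1 * W x 1 j) x ∧
        HasDerivAt (fun y => W y 1 j) (B x 1 0 * W x 0 j + B x 1 1 * W x 1 j) x) ∧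
      (W x).det ≠ 0 := by
  simp [IsFundamentalAt, Matrix.mul_apply, Fin.sum_univ_two, Fin.forall_fin_two]
  tauto

theorem exists_meromorphic_isFundamentalAt_of_double_pole {a b k m : ℂ → ℂ} {z c : ℂ} (ρ : ℂ)
    (hk : AnalyticAt ℂ k z) (hm : AnalyticAt ℂ m z)
    (ha : ∀ᶠ x in 𝓝[≠] z, a x = c * ((x - z) ^ 2)⁻¹ + k x)
    (hb : ∀ᶠ x in 𝓝[≠] z, b x = (x - z) ^ 2 * m x) :
    ∃ W : ℂ → Matrix (Fin 2) (Fin 2) ℂ, (∀ i j, MeromorphicAt (fun x => W x i j) z) ∧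
      ∀ᶠ x in 𝓝[≠] z, IsFundamentalAt (fun x => ρ • !![0, a x; b x, 0]) W x := by
  obtain ⟨V, hV⟩ := exists_isFundamentalAt_of_analyticAt (z := z)
    (B := fun x => !![ρ ^ 2 * c * (x - z) * m x, ρ * k x - ρ ^ 3 * c ^ 2 * m x;
      ρ * ((x - z) ^ 2 * m x), - (ρ ^ 2 * c * (x - z) * m x)])
    (by simp only [Fin.forall_fin_two]; simp; refine ⟨⟨?_, ?_⟩, ?_, ?_⟩ <;> fun_prop)
  have hVm : ∀ i j, MeromorphicAt (fun x => V x i j) z := fun i j =>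
    (Complex.analyticAt_iff_eventually_differentiableAt.2
      (hV.mono fun x hx => (hx.1 i j).differentiableAt)).meromorphicAt
  have hs : MeromorphicAt (fun x => -(ρ * c) * (x - z)⁻¹) z := by fun_prop
  refine ⟨fun x => !![V x 0 0 + -(ρ * c) * (x - z)⁻¹ * V x 1 0,
    V x 0 1 + -(ρ * c) * (x - z)⁻¹ * V x 1 1; V x 1 0, V x 1 1], ?_, ?_⟩
  · simp only [Fin.forall_fin_two]
    exact ⟨⟨(hVm 0 0).add (hs.mul (hVm 1 0)), (hVm 0 1).add (hs.mul (hVm 1 1))⟩, hVm 1 0, hVm 1 1⟩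
  · filter_upwards [ha, hb, hV.filter_mono nhdsWithin_le_nhds, self_mem_nhdsWithin] with
      x hax hbx hVx hxz
    have hxz' : x - z ≠ 0 := sub_ne_zero.2 hxz
    rw [IsFundamentalAt.fin_two] at hVx ⊢
    have hs' : HasDerivAt (fun x => -(ρ * c) * (x - z)⁻¹) (ρ * c * ((x - z) ^ 2)⁻¹) x := by
      have := (((hasDerivAt_id x).sub_const z).inv hxz').const_mul (-(ρ * c))
      refine this.congr_deriv ?_
      simp only [id]
      ring
    refine ⟨?_, ?_⟩
    · have key : ∀ j, HasDerivAt (fun x => V x 0 j + -(ρ * c) * (x - z)⁻¹ * V x 1 j)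
          (ρ * a x * V x 1 j) x ∧ HasDerivAt (fun x => V x 1 j)
          (ρ * b x * (V x 0 j + -(ρ * c) * (x - z)⁻¹ * V x 1 j)) x := by
        intro j
        obtain ⟨h0, h1⟩ := hVx.1 j
        refine ⟨(h0.add (hs'.mul h1)).congr_deriv ?_, h1.congr_deriv ?_⟩
        · simp [hax]; field_simp; ring
        · simp [hbx]; field_simp
      simp only [Fin.forall_fin_two]
      simpa using And.intro (key 0) (key 1)
    · have := hVx.2
      rw [Matrix.det_fin_two] at this ⊢
      simp only [Matrix.of_apply, Matrix.cons_val', Matrix.cons_val_zero, Matrix.cons_val_one,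
        Matrix.cons_val_fin_one]
      convert this using 1
      ring

theorem IsFundamentalAt.swap_rows {a b : ℂ → ℂ} {ρ x : ℂ} {W : ℂ → Matrix (Fin 2) (Fin 2) ℂ}
    (h : IsFundamentalAt (fun x => ρ • !![0, a x; b x, 0]) W x) :
    IsFundamentalAt (fun x => ρ • !![0, b x; a x, 0])
      (fun x => !![W x 1 0, W x 1 1; W x 0 0, W x 0 1]) x := by
  rw [IsFundamentalAt.fin_two, Matrix.det_fin_two] at h ⊢
  simp only [Fin.forall_fin_two] at h ⊢
  simp at h ⊢
  refine ⟨by tauto, fun h' => h.2 (by linear_combination -h')⟩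

theorem Convex.reProdIm {s t : Set ℝ} (hs : Convex ℝ s) (ht : Convex ℝ t) : Convex ℝ (s ×ℂ t) :=
  (hs.linear_preimage Complex.reLm).inter (ht.linear_preimage Complex.imLm)

/-- `W` is meromorphic on `U`, vanishes on `S`, and is a fundamental solution of `W' = M W`
on `U \ S`. -/
structure IsFundamentalOn (M : ℂ → Matrix (Fin 2) (Fin 2) ℂ) (S U : Set ℂ)
    (W : ℂ → Matrix (Fin 2) (Fin 2) ℂ) : Prop where
  meromorphicOn : ∀ i j, MeromorphicOn (fun x => W x i j) U
  eq_zero : ∀ x ∈ U, x ∈ S → W x = 0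
  isFundamentalAt : ∀ x ∈ U, x ∉ S → IsFundamentalAt M W x

namespace IsFundamentalOn

variable {M W W₁ W₂ : ℂ → Matrix (Fin 2) (Fin 2) ℂ} {S U V : Set ℂ}

theorem mono (h : IsFundamentalOn M S U W) (hVU : V ⊆ U) : IsFundamentalOn M S V W :=
  ⟨fun i j => (h.meromorphicOn i j).mono_set hVU, fun x hx => h.eq_zero x (hVU hx),
    fun x hx => h.isFundamentalAt x (hVU hx)⟩

theorem congr (h : IsFundamentalOn M S U W₁) (hU : IsOpen U) (hW : Set.EqOn W₁ W₂ U) :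
    IsFundamentalOn M S U W₂ := by
  refine ⟨fun i j => (h.meromorphicOn i j).congr (fun x hx => by simp only [hW hx]) hU,
    fun x hx hxS => hW hx ▸ h.eq_zero x hx hxS, fun x hx hxS => ?_⟩
  have := h.isFundamentalAt x hx hxS
  refine ⟨fun i j => ?_, hW hx ▸ this.2⟩
  rw [← hW hx]
  refine (this.1 i j).congr_of_eventuallyEq ?_
  filter_upwards [hU.mem_nhds hx] with y hy
  rw [hW hy]

theorem mul_const (h : IsFundamentalOn M S U W) {C : Matrix (Fin 2) (Fin 2) ℂ} (hC : C.det ≠ 0) :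
    IsFundamentalOn M S U fun x => W x * C := by
  refine ⟨fun i j => ?_, fun x hx hxS => by simp [h.eq_zero x hx hxS], fun x hx hxS => ⟨?_, ?_⟩⟩
  · simp only [Matrix.mul_apply, Fin.sum_univ_two]
    exact ((h.meromorphicOn i 0).mul (.const _)).add ((h.meromorphicOn i 1).mul (.const _))
  · intro i j
    have := (h.isFundamentalAt x hx hxS).1
    rw [← Matrix.mul_assoc]
    simp only [Matrix.mul_apply (M := W _), Matrix.mul_apply (M := M x * W x), Fin.sum_univ_two]
    exact ((this i 0).mul_const _).add ((this i 1).mul_const _)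
  · rw [Matrix.det_mul]
    exact mul_ne_zero (h.isFundamentalAt x hx hxS).2 hC

theorem union (hU : IsFundamentalOn M S U W) (hV : IsFundamentalOn M S V W) :
    IsFundamentalOn M S (U ∪ V) W :=
  ⟨fun i j x hx => hx.elim (hU.meromorphicOn i j x) (hV.meromorphicOn i j x),
    fun x hx => hx.elim (hU.eq_zero x) (hV.eq_zero x),
    fun x hx => hx.elim (hU.isFundamentalAt x) (hV.isFundamentalAt x)⟩

theorem exists_wronskian_eq (hM : ∀ x, (M x).trace = 0) (hU : IsOpen U) (hUc : IsPreconnected U)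
    (hS : ∀ x, ∀ᶠ y in 𝓝[≠] x, y ∉ S)
    (h₁ : IsFundamentalOn M S U W₁) (h₂ : IsFundamentalOn M S U W₂) (i j : Fin 2) :
    ∃ L, ∀ x ∈ U, x ∉ S → W₁ x 0 i * W₂ x 1 j - W₂ x 0 j * W₁ x 1 i = L := by
  refine MeromorphicOn.exists_eq_const_of_hasDerivAt_zero hU hUc (fun x _ => hS x)
    (((h₁.meromorphicOn 0 i).mul (h₂.meromorphicOn 1 j)).sub
      ((h₂.meromorphicOn 0 j).mul (h₁.meromorphicOn 1 i))) fun x hx hxS => ?_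
  have d₁ := (IsFundamentalAt.fin_two.1 (h₁.isFundamentalAt x hx hxS)).1 i
  have d₂ := (IsFundamentalAt.fin_two.1 (h₂.isFundamentalAt x hx hxS)).1 j
  have ht := hM x
  rw [Matrix.trace_fin_two] at ht
  refine ((d₁.1.mul d₂.2).sub (d₂.1.mul d₁.2)).congr_deriv ?_
  linear_combination (W₁ x 0 i * W₂ x 1 j - W₂ x 0 j * W₁ x 1 i) * ht

theorem exists_eq_mul_const (hM : ∀ x, (M x).trace = 0) (hU : IsOpen U) (hUc : IsPreconnected U)
    (hS : ∀ x, ∀ᶠ y in 𝓝[≠] x, y ∉ S)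
    (h₁ : IsFundamentalOn M S U W₁) (h₂ : IsFundamentalOn M S U W₂) :
    ∃ C : Matrix (Fin 2) (Fin 2) ℂ, C.det ≠ 0 ∧ ∀ x ∈ U, W₂ x = W₁ x * C := by
  rcases U.eq_empty_or_nonempty with rfl | ⟨x, hx⟩
  · exact ⟨1, by simp, by simp⟩
  obtain ⟨x₀, hx₀S, hx₀⟩ :=
    ((hS x).and (mem_nhdsWithin_of_mem_nhds (hU.mem_nhds hx))).exists
  choose L hL using fun i j => h₁.exists_wronskian_eq hM hU hUc hS h₂ i j
  obtain ⟨d, hd⟩ := h₁.exists_wronskian_eq hM hU hUc hS h₁ 0 1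
  have hdet : ∀ x ∈ U, x ∉ S → (W₁ x).det = d := fun x hx hxS => by
    rw [Matrix.det_fin_two, hd x hx hxS]
  have hd0 : d ≠ 0 := hdet x₀ hx₀ hx₀S ▸ (h₁.isFundamentalAt x₀ hx₀ hx₀S).2
  let C : Matrix (Fin 2) (Fin 2) ℂ := !![-L 1 0 / d, -L 1 1 / d; L 0 0 / d, L 0 1 / d]
  have hC : ∀ x ∈ U, x ∉ S → W₂ x = W₁ x * C := by
    intro x hx hxS
    have e := fun i j => hL i j x hx hxS
    have e' := hd x hx hxS
    ext i j
    rw [Matrix.mul_apply, Fin.sum_univ_two]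
    fin_cases i <;> fin_cases j <;> simp [C, ← e] <;> field_simp <;> rw [← e'] <;> ring
  refine ⟨C, ?_, fun x hx => ?_⟩
  · have := (h₂.isFundamentalAt x₀ hx₀ hx₀S).2
    rw [hC x₀ hx₀ hx₀S, Matrix.det_mul] at this
    exact right_ne_zero_of_mul this
  · by_cases hxS : x ∈ S
    · rw [h₁.eq_zero x hx hxS, h₂.eq_zero x hx hxS, Matrix.zero_mul]
    · exact hC x hx hxS

theorem exists_union (hM : ∀ x, (M x).trace = 0) (hU : IsOpen U) (hV : IsOpen V)
    (hUV : IsPreconnected (U ∩ V)) (hS : ∀ x, ∀ᶠ y in 𝓝[≠] x, y ∉ S)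
    (h₁ : IsFundamentalOn M S U W₁) (h₂ : IsFundamentalOn M S V W₂) :
    ∃ W, IsFundamentalOn M S (U ∪ V) W := by
  classical
  obtain ⟨C, hC, hW⟩ := exists_eq_mul_const hM (hU.inter hV) hUV hS
    (h₂.mono Set.inter_subset_right) (h₁.mono Set.inter_subset_left)
  refine ⟨fun x => if x ∈ U then W₁ x else W₂ x * C, union (h₁.congr hU fun x hx => ?_)
    ((h₂.mul_const hC).congr hV fun x hx => ?_)⟩
  · rw [if_pos hx]
  · by_cases hxU : x ∈ U
    · simp only [if_pos hxU, hW x ⟨hxU, hx⟩]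
    · simp only [if_neg hxU]

theorem exists_univ_of_forall_square (hM : ∀ x, (M x).trace = 0)
    (hS : ∀ x, ∀ᶠ y in 𝓝[≠] x, y ∉ S)
    (h : ∀ R : ℝ, ∃ W, IsFundamentalOn M S (Set.Ioo (-R) R ×ℂ Set.Ioo (-R) R) W) :
    ∃ W, IsFundamentalOn M S Set.univ W := by
  let Q : ℕ → Set ℂ := fun n => Set.Ioo (-(n + 1 : ℝ)) (n + 1) ×ℂ Set.Ioo (-(n + 1 : ℝ)) (n + 1)
  have hQo : ∀ n, IsOpen (Q n) := fun n => isOpen_Ioo.reProdIm isOpen_Ioo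
  have hQc : ∀ n, IsPreconnected (Q n) := fun n =>
    ((convex_Ioo _ _).reProdIm (convex_Ioo _ _)).isPreconnected
  have hQm : ∀ m n, m ≤ n → Q m ⊆ Q n := by
    intro m n hmn
    have : (m : ℝ) + 1 ≤ n + 1 := by gcongr
    exact Complex.reProdIm_subset_iff.2 (Set.prod_mono (Set.Ioo_subset_Ioo (neg_le_neg this) this)
      (Set.Ioo_subset_Ioo (neg_le_neg this) this))
  have hQx : ∀ x, x ∈ Q ⌈‖x‖⌉₊ := by
    intro x
    have h0 := Nat.le_ceil ‖x‖
    have h1 := abs_le.1 (Complex.abs_re_le_norm x)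
    have h2 := abs_le.1 (Complex.abs_im_le_norm x)
    refine Complex.mem_reProdIm.2 ⟨⟨?_, ?_⟩, ?_, ?_⟩ <;> linarith
  have h0Q : (0 : ℂ) ∈ Q 0 := by simpa using hQx 0
  obtain ⟨x₀, hx₀S, hx₀⟩ :=
    ((hS 0).and (mem_nhdsWithin_of_mem_nhds ((hQo 0).mem_nhds h0Q))).exists
  have hN : ∀ n : ℕ, ∃ W, IsFundamentalOn M S (Q n) W ∧ W x₀ = 1 := by
    intro n
    obtain ⟨W, hW⟩ := h (n + 1)
    have hdet := (hW.isFundamentalAt x₀ (hQm 0 n n.zero_le hx₀) hx₀S).2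
    refine ⟨_, hW.mul_const (C := (W x₀)⁻¹) ?_, Matrix.mul_nonsing_inv _ hdet.isUnit⟩
    rw [Matrix.det_nonsing_inv]
    exact hdet.isUnit.ringInverse.ne_zero
  choose W hW hW₁ using hN
  have hle : ∀ m n, m ≤ n → ∀ x ∈ Q m, W n x = W m x := by
    intro m n hmn
    obtain ⟨C, -, hC⟩ := exists_eq_mul_const hM (hQo m) (hQc m) hS (hW m) ((hW n).mono (hQm m n hmn))
    have hC1 := hC x₀ (hQm 0 m m.zero_le hx₀)
    rw [hW₁, hW₁, one_mul] at hC1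
    intro x hx
    rw [hC x hx, ← hC1, mul_one]
  have hG : ∀ m, IsFundamentalOn M S (Q m) fun x => W ⌈‖x‖⌉₊ x := fun m =>
    (hW m).congr (hQo m) fun x hx => by
      rcases le_total m ⌈‖x‖⌉₊ with hm | hm
      · exact (hle _ _ hm x hx).symm
      · exact hle _ _ hm x (hQx x)
  exact ⟨_, fun i j x _ => (hG _).meromorphicOn i j x (hQx x),
    fun x _ => (hG _).eq_zero x (hQx x), fun x _ => (hG _).isFundamentalAt x (hQx x)⟩

end IsFundamentalOn

theorem forall_of_local_of_glue {Q : ℝ → ℝ → Prop}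
    (hmono : ∀ a b a' b', a ≤ a' → b' ≤ b → Q a b → Q a' b')
    (hloc : ∀ x, ∃ δ > 0, Q (x - δ) (x + δ))
    (hglue : ∀ a b c d, Q a c → Q b d → a ≤ b → b < c → c ≤ d → Q a d) (a b : ℝ) : Q a b := by
  let T : Set ℝ := {t | ∃ s, t < s ∧ Q a s}
  have hTo : IsOpen T := by
    refine isOpen_iff_mem_nhds.2 fun t ⟨s, hts, hs⟩ => ?_
    filter_upwards [Iio_mem_nhds hts] with u hu using ⟨s, hu, hs⟩
  have hTc : IsClosed T := by
    refine isClosed_of_closure_subset fun t ht => ?_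
    obtain ⟨δ, hδ, hQ⟩ := hloc t
    obtain ⟨u, ⟨s, hus, hs⟩, hu⟩ := Metric.mem_closure_iff.1 ht δ hδ
    rw [Real.dist_eq, abs_lt] at hu
    rcases le_or_gt a (t - δ) with ha | ha
    · rcases le_or_gt s (t + δ) with hst | hst
      · exact ⟨t + δ, by linarith, hglue _ _ _ _ hs hQ ha (by linarith) hst⟩
      · exact ⟨s, by linarith, hs⟩
    · exact ⟨t + δ, by linarith, hmono _ _ _ _ ha.le le_rfl hQ⟩
  have hTn : T.Nonempty := by
    obtain ⟨δ, hδ, hQ⟩ := hloc a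
    exact ⟨a, a + δ, by linarith, hmono _ _ _ _ (by linarith) le_rfl hQ⟩
  have hb : b ∈ T := IsClopen.eq_univ ⟨hTc, hTo⟩ hTn ▸ Set.mem_univ b
  obtain ⟨s, hbs, hs⟩ := hb
  exact hmono _ _ _ _ le_rfl hbs.le hs

theorem IsFundamentalOn.exists_univ_of_local {M : ℂ → Matrix (Fin 2) (Fin 2) ℂ} {S : Set ℂ}
    (hM : ∀ x, (M x).trace = 0) (hS : ∀ x, ∀ᶠ y in 𝓝[≠] x, y ∉ S)
    (h : ∀ x, ∃ U ∈ 𝓝 x, ∃ W, IsFundamentalOn M S U W) :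
    ∃ W, IsFundamentalOn M S Set.univ W := by
  have hglue : ∀ I J I' J' : Set ℝ, IsOpen I → IsOpen J → IsOpen I' → IsOpen J' →
      Convex ℝ I → Convex ℝ J → Convex ℝ I' → Convex ℝ J' →
      (∃ W, IsFundamentalOn M S (I ×ℂ J) W) → (∃ W, IsFundamentalOn M S (I' ×ℂ J') W) →
      ∃ W, IsFundamentalOn M S ((I ×ℂ J) ∪ (I' ×ℂ J')) W := by
    rintro I J I' J' hI hJ hI' hJ' cI cJ cI' cJ' ⟨W, hW⟩ ⟨W', hW'⟩
    exact hW.exists_union hM (hI.reProdIm hJ) (hI'.reProdIm hJ')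
      ((cI.reProdIm cJ).inter (cI'.reProdIm cJ')).isPreconnected hS hW'
  have hsub : ∀ I J I' J' : Set ℝ, I ⊆ I' → J ⊆ J' → I ×ℂ J ⊆ I' ×ℂ J' := fun I J I' J' hI hJ =>
    Complex.reProdIm_subset_iff.2 (Set.prod_mono hI hJ)
  have hvert : ∀ t c d : ℝ, ∃ δ > 0, ∃ W,
      IsFundamentalOn M S (Set.Ioo (t - δ) (t + δ) ×ℂ Set.Ioo c d) W := by
    intro t
    refine forall_of_local_of_glue ?_ ?_ ?_
    · rintro a b a' b' ha hb ⟨δ, hδ, W, hW⟩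
      exact ⟨δ, hδ, W, hW.mono (hsub _ _ _ _ subset_rfl (Set.Ioo_subset_Ioo ha hb))⟩
    · intro y
      obtain ⟨U, hU, W, hW⟩ := h ⟨t, y⟩
      obtain ⟨ε, hε, hball⟩ := Metric.mem_nhds_iff.1 hU
      refine ⟨ε / 2, by positivity, ε / 2, by positivity, W, hW.mono fun w hw => hball ?_⟩
      obtain ⟨h1, h2⟩ := Complex.mem_reProdIm.1 hw
      have h3 := Complex.norm_le_abs_re_add_abs_im (w - ⟨t, y⟩)
      have h4 : |w.re - t| < ε / 2 := abs_lt.2 ⟨by linarith [h1.1], by linarith [h1.2]⟩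
      have h5 : |w.im - y| < ε / 2 := abs_lt.2 ⟨by linarith [h2.1], by linarith [h2.2]⟩
      rw [mem_ball_iff_norm]
      simp only [Complex.sub_re, Complex.sub_im] at h3
      linarith
    · rintro a b c d ⟨δ, hδ, W, hW⟩ ⟨δ', hδ', W', hW'⟩ hab hbc hcd
      have l := min_le_left δ δ'
      have l' := min_le_right δ δ'
      obtain ⟨W'', h''⟩ := hglue _ _ _ _ isOpen_Ioo isOpen_Ioo isOpen_Ioo isOpen_Ioo
        (convex_Ioo _ _) (convex_Ioo _ _) (convex_Ioo _ _) (convex_Ioo _ _)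
        ⟨W, hW.mono (hsub (Set.Ioo (t - min δ δ') (t + min δ δ')) _ _ _
          (Set.Ioo_subset_Ioo (by linarith) (by linarith)) subset_rfl)⟩
        ⟨W', hW'.mono (hsub (Set.Ioo (t - min δ δ') (t + min δ δ')) _ _ _
          (Set.Ioo_subset_Ioo (by linarith) (by linarith)) subset_rfl)⟩
      refine ⟨min δ δ', lt_min hδ hδ', W'', h''.mono fun w hw => ?_⟩
      obtain ⟨h1, h2⟩ := Complex.mem_reProdIm.1 hw
      rcases lt_or_ge w.im c with hc | hc
      · exact .inl (Complex.mem_reProdIm.2 ⟨h1, h2.1, hc⟩)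
      · exact .inr (Complex.mem_reProdIm.2 ⟨h1, hbc.trans_le hc, h2.2⟩)
  refine exists_univ_of_forall_square hM hS fun R => ?_
  refine forall_of_local_of_glue
    (Q := fun a b => ∃ W, IsFundamentalOn M S (Set.Ioo a b ×ℂ Set.Ioo (-R) R) W)
    ?_ (fun t => hvert t _ _) ?_ _ _
  · rintro a b a' b' ha hb ⟨W, hW⟩
    exact ⟨W, hW.mono (hsub _ _ _ _ (Set.Ioo_subset_Ioo ha hb) subset_rfl)⟩
  · intro a b c d hW hW' hab hbc hcd
    obtain ⟨W'', h''⟩ := hglue _ _ _ _ isOpen_Ioo isOpen_Ioo isOpen_Ioo isOpen_Ioo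
        (convex_Ioo _ _) (convex_Ioo _ _) (convex_Ioo _ _) (convex_Ioo _ _) hW hW'
    refine ⟨W'', h''.mono fun w hw => ?_⟩
    obtain ⟨h1, h2⟩ := Complex.mem_reProdIm.1 hw
    rcases lt_or_ge w.re c with hc | hc
    · exact .inl (Complex.mem_reProdIm.2 ⟨⟨h1.1, hc⟩, h2⟩)
    · exact .inr (Complex.mem_reProdIm.2 ⟨⟨hbc.trans_le hc, h1.2⟩, h2⟩)

theorem IsFundamentalOn.exists_of_meromorphicAt {M W : ℂ → Matrix (Fin 2) (Fin 2) ℂ} {S : Set ℂ}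
    {x : ℂ} (hW : ∀ i j, MeromorphicAt (fun y => W y i j) x) (hS : ∀ᶠ y in 𝓝[≠] x, y ∉ S)
    (hF : ∀ᶠ y in 𝓝[≠] x, IsFundamentalAt M W y) (hx : x ∉ S → IsFundamentalAt M W x) :
    ∃ U ∈ 𝓝 x, ∃ W', IsFundamentalOn M S U W' := by
  classical
  obtain ⟨ε, hε, hball⟩ := Metric.eventually_nhds_iff_ball.1
    (eventually_nhdsWithin_iff.1 (hS.and hF))
  have hWW : ∀ y, (∀ᶠ w in 𝓝[≠] y, w ∉ S) →
      (fun w => if w ∈ S then 0 else W w) =ᶠ[𝓝[≠] y] W := fun y hy => hy.mono fun w hw => if_neg hw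
  have hS' : ∀ y ∈ ball x ε, ∀ᶠ w in 𝓝[≠] y, w ∉ S := by
    intro y hy
    rcases eq_or_ne y x with rfl | hyx
    · exact hS
    filter_upwards [mem_nhdsWithin_of_mem_nhds (isOpen_ball.mem_nhds hy),
      mem_nhdsWithin_of_mem_nhds (isOpen_compl_singleton.mem_nhds hyx)] with w hw hwx
    exact (hball w hw hwx).1
  have hF' : ∀ y ∈ ball x ε, y ∉ S → IsFundamentalAt M W y := by
    intro y hy hyS
    rcases eq_or_ne y x with rfl | hyx
    · exact hx hyS
    · exact (hball y hy hyx).2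
  have hWm : ∀ y ∈ ball x ε, ∀ i j, MeromorphicAt (fun w => W w i j) y := by
    intro y hy i j
    rcases eq_or_ne y x with rfl | hyx
    · exact hW i j
    refine (Complex.analyticAt_iff_eventually_differentiableAt.2 ?_).meromorphicAt
    filter_upwards [isOpen_ball.mem_nhds hy, isOpen_compl_singleton.mem_nhds hyx] with w hw hwx
    exact ((hball w hw hwx).2.1 i j).differentiableAt
  refine ⟨ball x ε, ball_mem_nhds x hε, fun w => if w ∈ S then 0 else W w, ?_, ?_, ?_⟩
  · intro i j y hy
    refine (hWm y hy i j).congr ?_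
    filter_upwards [hWW y (hS' y hy)] with w hw
    rw [hw]
  · intro y _ hyS
    exact if_pos hyS
  · intro y hy hyS
    have hev : (fun w => if w ∈ S then 0 else W w) =ᶠ[𝓝 y] W := by
      have := eventually_nhdsWithin_iff.1 (hWW y (hS' y hy))
      filter_upwards [this] with w hw
      rcases eq_or_ne w y with rfl | hwy
      · exact if_neg hyS
      · exact hw hwy
    refine ⟨fun i j => ?_, ?_⟩
    · simp only [if_neg hyS]
      refine ((hF' y hy hyS).1 i j).congr_of_eventuallyEq ?_
      filter_upwards [hev] with w hw
      rw [hw]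
    · simp only [if_neg hyS]
      exact (hF' y hy hyS).2

theorem AnalyticAt.dslope_self {f : ℂ → ℂ} {z : ℂ} (hf : AnalyticAt ℂ f z) :
    AnalyticAt ℂ (dslope f z) z := by
  rw [Complex.analyticAt_iff_eventually_differentiableAt]
  obtain ⟨ε, hε, hball⟩ := Metric.eventually_nhds_iff_ball.1
    (Complex.analyticAt_iff_eventually_differentiableAt.1 hf)
  have : DifferentiableOn ℂ (dslope f z) (ball z ε) :=
    (Complex.differentiableOn_dslope (ball_mem_nhds z hε)).2
      fun x hx => (hball x hx).differentiableWithinAt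
  filter_upwards [ball_mem_nhds z hε] with x hx
  exact this.differentiableAt (isOpen_ball.mem_nhds hx)

theorem eq_sub_mul_dslope {f : ℂ → ℂ} {z : ℂ} (x : ℂ) : f x = f z + (x - z) * dslope f z x := by
  have := sub_smul_dslope f z x
  rw [smul_eq_mul] at this
  rw [this]
  ring

theorem exists_double_pole_of_deriv_deriv_eq_zero {p : ℂ → ℂ} {z : ℂ} (hp : AnalyticAt ℂ p z)
    (h0 : p z = 0) (h1 : deriv p z ≠ 0) (h2 : deriv (deriv p) z = 0) :
    ∃ (c : ℂ) (k m : ℂ → ℂ), AnalyticAt ℂ k z ∧ AnalyticAt ℂ m z ∧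
      (∀ᶠ x in 𝓝[≠] z, (p x ^ 2)⁻¹ = c * ((x - z) ^ 2)⁻¹ + k x) ∧
      ∀ᶠ x in 𝓝[≠] z, p x ^ 2 = (x - z) ^ 2 * m x := by
  set g := dslope p z with hg
  have hga : AnalyticAt ℂ g z := hp.dslope_self
  have hpg : ∀ x, p x = (x - z) * g x := fun x => by
    rw [eq_sub_mul_dslope (f := p) (z := z) x, h0, zero_add]
  have hgz : g z ≠ 0 := by rwa [hg, dslope_same]
  have hdp : deriv p =ᶠ[𝓝 z] fun x => g x + (x - z) * deriv g x := by
    filter_upwards [hga.eventually_analyticAt] with x hx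
    have := ((hasDerivAt_id x).sub_const z).mul hx.differentiableAt.hasDerivAt
    have h := (this.congr_of_eventuallyEq (Eventually.of_forall hpg)).deriv
    simpa using h
  have hg1 : deriv g z = 0 := by
    have := hga.differentiableAt.hasDerivAt.add
      (((hasDerivAt_id z).sub_const z).mul hga.deriv.differentiableAt.hasDerivAt)
    have h := (this.congr_of_eventuallyEq hdp).deriv
    rw [h2] at h
    simp at h
    linear_combination -(1 / 2) * h
  let h : ℂ → ℂ := fun x => (g x ^ 2)⁻¹
  have hha : AnalyticAt ℂ h z := (hga.pow 2).inv (pow_ne_zero 2 hgz)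
  have hh1 : deriv h z = 0 := by
    have := (hga.differentiableAt.hasDerivAt.pow 2).inv (pow_ne_zero 2 hgz)
    rw [hg1] at this
    refine (HasDerivAt.deriv (f := h) this).trans ?_
    simp
  refine ⟨h z, dslope (dslope h z) z, fun x => g x ^ 2, hha.dslope_self.dslope_self, hga.pow 2,
    ?_, Eventually.of_forall fun x => by simp only [hpg x, mul_pow]⟩
  filter_upwards [self_mem_nhdsWithin] with x hx
  have hxz : x - z ≠ 0 := sub_ne_zero.2 hx
  have e1 := eq_sub_mul_dslope (f := h) (z := z) x
  have e2 := eq_sub_mul_dslope (f := dslope h z) (z := z) x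
  rw [dslope_same, hh1, zero_add] at e2
  rw [hpg x, mul_pow, mul_inv]
  change _ * h x = _
  rw [e1, e2]
  field_simp

theorem deriv_deriv_eq_zero_of_analytic_solution {p G : ℂ → ℂ} {z : ℂ} (hp : AnalyticAt ℂ p z)
    (h0 : p z = 0) (h1 : deriv p z ≠ 0) (hG : AnalyticAt ℂ G z) (hGz : G z ≠ 0)
    (h : ∀ᶠ x in 𝓝 z, p x * deriv (deriv G) x = 2 * deriv p x * deriv G x + p x * G x) :
    deriv (deriv p) z = 0 := by
  have hD : ∀ᶠ x in 𝓝 z,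
      deriv p x * deriv (deriv G) x + p x * deriv (deriv (deriv G)) x =
        2 * deriv (deriv p) x * deriv G x + 2 * deriv p x * deriv (deriv G) x
          + (deriv p x * G x + p x * deriv G x) := by
    filter_upwards [h.eventually_nhds, hp.eventually_analyticAt, hG.eventually_analyticAt]
      with x hx hpx hGx
    have l := hpx.differentiableAt.hasDerivAt.mul hGx.deriv.deriv.differentiableAt.hasDerivAt
    have r := ((hpx.deriv.differentiableAt.hasDerivAt.const_mul 2).mul
      hGx.deriv.differentiableAt.hasDerivAt).add
        (hpx.differentiableAt.hasDerivAt.mul hGx.differentiableAt.hasDerivAt)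
    exact l.unique (r.congr_of_eventuallyEq hx)
  have hDD : deriv (deriv p) z * deriv (deriv G) z + deriv p z * deriv (deriv (deriv G)) z
      + (deriv p z * deriv (deriv (deriv G)) z + p z * deriv (deriv (deriv (deriv G))) z) =
      2 * deriv (deriv (deriv p)) z * deriv G z + 2 * deriv (deriv p) z * deriv (deriv G) z
      + (2 * deriv (deriv p) z * deriv (deriv G) z + 2 * deriv p z * deriv (deriv (deriv G)) z)
      + (deriv (deriv p) z * G z + deriv p z * deriv G z
        + (deriv p z * deriv G z + p z * deriv (deriv G) z)) := by
    have p0 := hp.differentiableAt.hasDerivAt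
    have p1 := hp.deriv.differentiableAt.hasDerivAt
    have p2 := hp.deriv.deriv.differentiableAt.hasDerivAt
    have g0 := hG.differentiableAt.hasDerivAt
    have g1 := hG.deriv.differentiableAt.hasDerivAt
    have g2 := hG.deriv.deriv.differentiableAt.hasDerivAt
    have g3 := hG.deriv.deriv.deriv.differentiableAt.hasDerivAt
    have l := (p1.mul g2).add (p0.mul g3)
    have r := (((p2.const_mul 2).mul g1).add ((p1.const_mul 2).mul g2)).add
      ((p1.mul g0).add (p0.mul g1))
    exact l.unique (r.congr_of_eventuallyEq hD)
  have e0 := h.self_of_nhds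
  have e1 := hD.self_of_nhds
  rw [h0] at e0 e1 hDD
  have hG1 : deriv G z = 0 := by
    have : deriv p z * deriv G z = 0 := by linear_combination -(1 / 2) * e0
    exact (mul_eq_zero.1 this).resolve_left h1
  rw [hG1] at e1 hDD
  have hG2 : deriv (deriv G) z = -G z := by
    have : deriv p z * (deriv (deriv G) z + G z) = 0 := by linear_combination -e1
    exact eq_neg_of_add_eq_zero_left ((mul_eq_zero.1 this).resolve_left h1)
  rw [hG2] at hDD
  have : deriv (deriv p) z * G z = 0 := by linear_combination (1 / 2) * hDD
  exact (mul_eq_zero.1 this).resolve_right hGz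

theorem AnalyticAt.meromorphicOrderAt_eq_one {p : ℂ → ℂ} {z : ℂ} (hp : AnalyticAt ℂ p z)
    (h0 : p z = 0) (h1 : deriv p z ≠ 0) : meromorphicOrderAt p z = (1 : ℤ) := by
  rw [meromorphicOrderAt_eq_int_iff hp.meromorphicAt]
  refine ⟨dslope p z, hp.dslope_self, by rwa [dslope_same], Eventually.of_forall fun x => ?_⟩
  rw [zpow_one, smul_eq_mul, eq_sub_mul_dslope (f := p) (z := z) x, h0, zero_add]

theorem meromorphicOrderAt_solution {p f g : ℂ → ℂ} {z : ℂ} (hp : AnalyticAt ℂ p z)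
    (h0 : p z = 0) (h1 : deriv p z ≠ 0) (hf : MeromorphicAt f z)
    (hpz : ∀ᶠ x in 𝓝[≠] z, p x ≠ 0)
    (hdf : ∀ᶠ x in 𝓝[≠] z, HasDerivAt f ((p x ^ 2)⁻¹ * g x) x)
    (hdg : ∀ᶠ x in 𝓝[≠] z, HasDerivAt g (p x ^ 2 * f x) x) :
    meromorphicOrderAt g z = 0 ∨ 0 < meromorphicOrderAt g z ∧ 0 ≤ meromorphicOrderAt f z := by
  have hp2 : meromorphicOrderAt (fun x => p x ^ 2) z = (2 : ℤ) := by
    rw [fun_meromorphicOrderAt_pow hp.meromorphicAt, hp.meromorphicOrderAt_eq_one h0 h1]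
    rfl
  have hpm : MeromorphicAt (fun x => p x ^ 2) z := hp.meromorphicAt.pow 2
  have hg' : meromorphicOrderAt (deriv g) z = (2 : ℤ) + meromorphicOrderAt f z := by
    rw [meromorphicOrderAt_congr (hdg.mono fun x hx => hx.deriv),
      fun_meromorphicOrderAt_mul hpm hf, hp2]
  have hf' : (2 : ℤ) + meromorphicOrderAt (deriv f) z = meromorphicOrderAt g z := by
    rw [← hp2, ← meromorphicOrderAt_mul hpm hf.deriv]
    refine meromorphicOrderAt_congr ?_
    filter_upwards [hdf, hpz] with x hx hpx
    rw [Pi.mul_apply, hx.deriv]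
    field_simp
  rcases eq_or_ne (meromorphicOrderAt g z) ⊤ with ht | ht
  · right
    have hf0 : meromorphicOrderAt f z = ⊤ := by
      have h2 := meromorphicOrderAt_eq_top_iff.1 ht
      rw [meromorphicOrderAt_eq_top_iff]
      have h3 := eventually_eventually_nhdsWithin.2 h2
      filter_upwards [hdg, hpz, h3, self_mem_nhdsWithin] with x hx hpx hx3 hxz
      rw [nhdsWithin_eq_nhds.2 (isOpen_compl_singleton.mem_nhds hxz)] at hx3
      have := hx.unique ((hasDerivAt_const x (0 : ℂ)).congr_of_eventuallyEq hx3)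
      exact (mul_eq_zero.1 this).resolve_left (pow_ne_zero 2 hpx)
    simp [ht, hf0]
  · obtain ⟨n, hn⟩ := WithTop.ne_top_iff_exists.1 ht
    by_cases hn0 : n = 0
    · left
      rw [← hn, hn0]
      rfl
    right
    rw [meromorphicOrderAt_deriv_eq_sub_one (by exact_mod_cast hn0) hn.symm] at hg'
    have htf : meromorphicOrderAt f z ≠ ⊤ := by
      intro h
      rw [h] at hg'
      exact WithTop.coe_ne_top hg'
    obtain ⟨m, hm⟩ := WithTop.ne_top_iff_exists.1 htf
    rw [← hm] at hg'
    have e1 : n - 1 = 2 + m := by exact_mod_cast hg'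
    by_cases hm0 : m = 0
    · rw [← hn, ← hm, hm0]
      have : (0 : ℤ) < n := by omega
      exact ⟨by exact_mod_cast this, le_rfl⟩
    · rw [meromorphicOrderAt_deriv_eq_sub_one (by exact_mod_cast hm0) hm.symm, ← hn] at hf'
      have e2 : 2 + (m - 1) = n := by exact_mod_cast hf'
      omega

theorem deriv_deriv_eq_zero_of_meromorphic_fundamental {p : ℂ → ℂ} {z : ℂ}
    {W : ℂ → Matrix (Fin 2) (Fin 2) ℂ} (hp : AnalyticAt ℂ p z)
    (h0 : p z = 0) (h1 : deriv p z ≠ 0) (hW : ∀ i j, MeromorphicAt (fun x => W x i j) z)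
    (hpz : ∀ᶠ x in 𝓝[≠] z, p x ≠ 0)
    (hF : ∀ᶠ x in 𝓝[≠] z,
      IsFundamentalAt (fun x => (1 : ℂ) • !![0, (p x ^ 2)⁻¹; p x ^ 2, 0]) W x) :
    deriv (deriv p) z = 0 := by
  have hF' : ∀ᶠ x in 𝓝[≠] z, ∀ j, HasDerivAt (fun y => W y 0 j) ((p x ^ 2)⁻¹ * W x 1 j) x ∧
      HasDerivAt (fun y => W y 1 j) (p x ^ 2 * W x 0 j) x := by
    filter_upwards [hF] with x hx j
    simpa using (IsFundamentalAt.fin_two.1 hx).1 j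
  obtain ⟨j, hj⟩ : ∃ j, meromorphicOrderAt (fun x => W x 1 j) z = 0 := by
    by_contra! hne
    have hpos := fun j => (meromorphicOrderAt_solution hp h0 h1 (hW 0 j) hpz
      (hF'.mono fun x hx => (hx j).1) (hF'.mono fun x hx => (hx j).2)).resolve_left (hne j)
    have hg := fun j => tendsto_zero_of_meromorphicOrderAt_pos (hpos j).1
    choose l hl using fun j => tendsto_nhds_of_meromorphicOrderAt_nonneg (hW 0 j) (hpos j).2
    have hdet : Tendsto (fun x => (W x).det) (𝓝[≠] z) (𝓝 0) := by
      simp only [Matrix.det_fin_two]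
      simpa using ((hl 0).mul (hg 1)).sub ((hl 1).mul (hg 0))
    have hdm : MeromorphicAt (fun x => (W x).det) z := by
      simp only [Matrix.det_fin_two]
      exact ((hW 0 0).mul (hW 1 1)).sub ((hW 0 1).mul (hW 1 0))
    obtain ⟨L, hL⟩ := hdm.eventually_eq_const_of_deriv_eq_zero <| by
      filter_upwards [hF'] with x hx
      simp only [Matrix.det_fin_two]
      refine (HasDerivAt.deriv (f := fun x => W x 0 0 * W x 1 1 - W x 0 1 * W x 1 0)
        (((hx 0).1.mul (hx 1).2).sub ((hx 1).1.mul (hx 0).2))).trans ?_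
      ring
    have hL0 : L = 0 := tendsto_nhds_unique
      (tendsto_const_nhds.congr' (hL.mono fun x hx => hx.symm)) hdet
    obtain ⟨x, hx, hx'⟩ := (hL.and hF).exists
    exact hx'.2 (hx.trans hL0)
  obtain ⟨G, hG, hGz, hWG⟩ := (meromorphicOrderAt_eq_int_iff (n := 0) (hW 1 j)).1 (by simpa using hj)
  simp only [zpow_zero, one_smul] at hWG
  refine deriv_deriv_eq_zero_of_analytic_solution hp h0 h1 hG hGz ?_
  have hpc := hp.deriv
  have hG1 := hG.deriv
  have hG2 := hG1.deriv
  refine ((hp.mul hG2).frequently_eq_iff_eventually_eq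
    (((analyticAt_const (v := (2 : ℂ))).mul hpc |>.mul hG1).add (hp.mul hG))).1
      (Eventually.frequently ?_)
  have hloc : ∀ᶠ x in 𝓝[≠] z, ∀ᶠ y in 𝓝 x, W y 1 j = G y ∧
      HasDerivAt (fun y => W y 1 j) (p y ^ 2 * W y 0 j) y := by
    have := eventually_eventually_nhdsWithin.2 (hWG.and hF')
    filter_upwards [this, self_mem_nhdsWithin] with x hx hxz
    rw [nhdsWithin_eq_nhds.2 (isOpen_compl_singleton.mem_nhds hxz)] at hx
    exact hx.mono fun y hy => ⟨hy.1, (hy.2 j).2⟩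
  filter_upwards [hloc, hF', hpz, hp.eventually_analyticAt.filter_mono nhdsWithin_le_nhds]
    with x hx hFx hpx hpax
  have hd : deriv G =ᶠ[𝓝 x] fun y => p y ^ 2 * W y 0 j := by
    filter_upwards [hx.eventually_nhds] with y hy
    have : G =ᶠ[𝓝 y] fun y => W y 1 j := hy.mono fun w hw => hw.1.symm
    exact (hy.self_of_nhds.2.congr_of_eventuallyEq this).deriv
  have hdd := (((hpax.differentiableAt.hasDerivAt.pow 2).mul
    (hFx j).1).congr_of_eventuallyEq hd).deriv
  have hd0 : deriv G x = p x ^ 2 * W x 0 j := hd.self_of_nhds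
  change p x * deriv (deriv G) x = 2 * deriv p x * deriv G x + p x * G x
  rw [hdd, hd0, hx.self_of_nhds.1, Pi.pow_apply, mul_inv_cancel_left₀ (pow_ne_zero 2 hpx)]
  ring

theorem MeromorphicOn.eventually_analyticAt_and_ne_zero {r : ℂ → ℂ} (hr : MeromorphicOn r Set.univ)
    (hzeros : ∀ z, AnalyticAt ℂ r z → r z = 0 → deriv r z ≠ 0) (z : ℂ) :
    ∀ᶠ x in 𝓝[≠] z, AnalyticAt ℂ r x ∧ r x ≠ 0 := by
  have ha := (hr z trivial).eventually_analyticAt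
  rcases (hr z trivial).eventually_eq_zero_or_eventually_ne_zero with h | h
  · obtain ⟨x, ⟨hx, hxa⟩, hxz⟩ := (((eventually_eventually_nhdsWithin.2 h).and ha).and
      self_mem_nhdsWithin).exists
    rw [nhdsWithin_eq_nhds.2 (isOpen_compl_singleton.mem_nhds hxz)] at hx
    refine absurd ?_ (hzeros x hxa hx.self_of_nhds)
    exact ((hasDerivAt_const x (0 : ℂ)).congr_of_eventuallyEq hx).deriv
  · exact ha.and h

theorem exists_meromorphic_isFundamentalAt_of_deriv_deriv_eq_zero {p : ℂ → ℂ} {z : ℂ} (ρ : ℂ)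
    (hp : AnalyticAt ℂ p z) (h0 : p z = 0) (h1 : deriv p z ≠ 0) (h2 : deriv (deriv p) z = 0) :
    ∃ W : ℂ → Matrix (Fin 2) (Fin 2) ℂ, (∀ i j, MeromorphicAt (fun x => W x i j) z) ∧
      ∀ᶠ x in 𝓝[≠] z, IsFundamentalAt (fun x => ρ • !![0, (p x ^ 2)⁻¹; p x ^ 2, 0]) W x := by
  obtain ⟨c, k, m, hk, hm, ha, hb⟩ := exists_double_pole_of_deriv_deriv_eq_zero hp h0 h1 h2
  exact exists_meromorphic_isFundamentalAt_of_double_pole ρ hk hm ha hb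

theorem IsFundamentalAt.swap_rows_inv {p q : ℂ → ℂ} {ρ z : ℂ} {W : ℂ → Matrix (Fin 2) (Fin 2) ℂ}
    (h : q z = (p z)⁻¹)
    (hW : IsFundamentalAt (fun x => ρ • !![0, (p x ^ 2)⁻¹; p x ^ 2, 0]) W z) :
    IsFundamentalAt (fun x => ρ • !![0, (q x ^ 2)⁻¹; q x ^ 2, 0])
      (fun x => !![W x 1 0, W x 1 1; W x 0 0, W x 0 1]) z := by
  have := hW.swap_rows
  simp only [IsFundamentalAt, h, inv_pow, inv_inv] at this ⊢
  exact this

theorem MeromorphicAt.swap_rows {W : ℂ → Matrix (Fin 2) (Fin 2) ℂ} {z : ℂ}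
    (hW : ∀ i j, MeromorphicAt (fun x => W x i j) z) (i j : Fin 2) :
    MeromorphicAt (fun x => !![W x 1 0, W x 1 1; W x 0 0, W x 0 1] i j) z := by
  fin_cases i <;> fin_cases j
  exacts [hW 1 0, hW 1 1, hW 0 0, hW 0 1]

theorem stmt_11 (r q : ℂ → ℂ)
    (hr : MeromorphicOn r Set.univ) (hq : MeromorphicOn q Set.univ)
    -- q = 1/r away from the zeros and poles of r
    (hqr : ∀ z : ℂ, AnalyticAt ℂ r z → r z ≠ 0 → q z = (r z)⁻¹)
    -- r is not identically zero
    (hne : ∃ z : ℂ, AnalyticAt ℂ r z ∧ r z ≠ 0)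
    -- all zeros of r are simple
    (hzeros : ∀ z : ℂ, AnalyticAt ℂ r z → r z = 0 → deriv r z ≠ 0)
    -- all poles of r are simple: each pole is a simple zero of q = 1/r
    (hpoles : ∀ y : ℂ, ¬ AnalyticAt ℂ r y →
      AnalyticAt ℂ q y ∧ q y = 0 ∧ deriv q y ≠ 0)
    (A : ℂ → Matrix (Fin 2) (Fin 2) ℂ)
    (hA : ∀ x : ℂ, A x = !![0, ((r x) ^ 2)⁻¹; (r x) ^ 2, 0]) :
    (∀ ρ : ℂ, ∃ W : ℂ → Matrix (Fin 2) (Fin 2) ℂ,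
      -- the entries of W are meromorphic on all of ℂ
      (∀ i j, MeromorphicOn (fun x => W x i j) Set.univ) ∧
      -- off the zeros and poles of r, wherever W is analytic, W solves
      -- dW/dx = ρA(x)W and det W ≠ 0
      (∀ x : ℂ, AnalyticAt ℂ r x → r x ≠ 0 →
        (∀ i j, AnalyticAt ℂ (fun y => W y i j) x) →
        (∀ i j, HasDerivAt (fun y => W y i j) ((ρ • A x * W x) i j) x) ∧
          (W x).det ≠ 0)) ↔
    ((∀ z : ℂ, AnalyticAt ℂ r z → r z = 0 → deriv (deriv r) z = 0) ∧
     (∀ y : ℂ, ¬ AnalyticAt ℂ r y → deriv (deriv q) y = 0)) := by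
  obtain rfl : A = fun x => !![0, ((r x) ^ 2)⁻¹; (r x) ^ 2, 0] := funext hA
  have hN := hr.eventually_analyticAt_and_ne_zero hzeros
  have hqN : ∀ z, ∀ᶠ x in 𝓝[≠] z, q x = (r x)⁻¹ := fun z => (hN z).mono fun x hx => hqr x hx.1 hx.2
  constructor
  · intro h
    obtain ⟨W, hW, hF⟩ := h 1
    have hF' : ∀ z, ∀ᶠ x in 𝓝[≠] z,
        IsFundamentalAt (fun x => (1 : ℂ) • !![0, (r x ^ 2)⁻¹; r x ^ 2, 0]) W x := by
      intro z
      filter_upwards [hN z, eventually_all.2 fun i => eventually_all.2 fun j =>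
        (hW i j z trivial).eventually_analyticAt] with x hx hWx
      exact hF x hx.1 hx.2 hWx
    refine ⟨fun z hz h0 => ?_, fun y hy => ?_⟩
    · exact deriv_deriv_eq_zero_of_meromorphic_fundamental hz h0 (hzeros z hz h0)
        (fun i j => hW i j z trivial) ((hN z).mono fun x hx => hx.2) (hF' z)
    · obtain ⟨hqa, h0, h1⟩ := hpoles y hy
      refine deriv_deriv_eq_zero_of_meromorphic_fundamental hqa h0 h1
        (MeromorphicAt.swap_rows fun i j => hW i j y trivial) ?_ ?_
      · filter_upwards [hN y, hqN y] with x hx hqx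
        rw [hqx]
        exact inv_ne_zero hx.2
      · filter_upwards [hF' y, hqN y] with x hx hqx
        exact hx.swap_rows_inv hqx
  · rintro ⟨hz2, hp2⟩ ρ
    let M : ℂ → Matrix (Fin 2) (Fin 2) ℂ := fun x => ρ • !![0, (r x ^ 2)⁻¹; r x ^ 2, 0]
    let S : Set ℂ := {x | ¬(AnalyticAt ℂ r x ∧ r x ≠ 0)}
    have hS : ∀ x, ∀ᶠ y in 𝓝[≠] x, y ∉ S := fun x => (hN x).mono fun y hy hyS => hyS hy
    have hM : ∀ x, (M x).trace = 0 := fun x => by simp [M, Matrix.trace_fin_two]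
    have hloc : ∀ x, ∃ U ∈ 𝓝 x, ∃ W, IsFundamentalOn M S U W := by
      intro x
      by_cases hra : AnalyticAt ℂ r x
      · by_cases h0 : r x = 0
        · obtain ⟨W, hW, hF⟩ := exists_meromorphic_isFundamentalAt_of_deriv_deriv_eq_zero ρ hra h0
            (hzeros x hra h0) (hz2 x hra h0)
          exact IsFundamentalOn.exists_of_meromorphicAt hW (hS x) hF
            fun hx => absurd (fun hx' => hx'.2 h0) hx
        · have hMa : ∀ i j, AnalyticAt ℂ (fun y => M y i j) x := by
            have h2 := hra.pow 2
            have h2' := h2.inv (pow_ne_zero 2 h0)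
            intro i j
            fin_cases i <;> fin_cases j
            · simpa [M] using analyticAt_const
            · exact analyticAt_const.mul h2'
            · exact analyticAt_const.mul h2
            · simpa [M] using analyticAt_const
          obtain ⟨W, hW⟩ := exists_isFundamentalAt_of_analyticAt hMa
          refine IsFundamentalOn.exists_of_meromorphicAt (fun i j => ?_) (hS x)
            (hW.filter_mono nhdsWithin_le_nhds) fun _ => hW.self_of_nhds
          refine AnalyticAt.meromorphicAt (Complex.analyticAt_iff_eventually_differentiableAt.2 ?_)
          exact hW.mono fun y hy => (hy.1 i j).differentiableAt
      · obtain ⟨hqa, h0, h1⟩ := hpoles x hra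
        obtain ⟨W, hW, hF⟩ := exists_meromorphic_isFundamentalAt_of_deriv_deriv_eq_zero ρ hqa h0 h1
          (hp2 x hra)
        refine IsFundamentalOn.exists_of_meromorphicAt (MeromorphicAt.swap_rows hW) (hS x) ?_
          fun hx => absurd (fun hx' => hra hx'.1) hx
        filter_upwards [hF, hqN x] with y hy hqy
        exact hy.swap_rows_inv (by rw [hqy, inv_inv])
    obtain ⟨W, hW⟩ := IsFundamentalOn.exists_univ_of_local hM hS hloc
    refine ⟨W, hW.meromorphicOn, fun x hx h0 _ => ?_⟩
    exact hW.isFundamentalAt x trivial fun hxS => hxS ⟨hx, h0⟩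
end

section
/- There exist polynomials p, q with complex coefficients, q not identically zero, with the following property: for every ξ > 0 at which the operator S_ξ is invertible on L²(0,ξ), the equation g(x) + ∫₀^ξ k(x−t) g(t) dt = 1 (0 < x < ξ) has a unique solution g(·,ξ) in L²(0,ξ); this solution coincides with a polynomial in x (so in particular has a continuous representative), and its boundary value satisfies q(ξ) ≠ 0 and g(ξ,ξ) = p(ξ)/q(ξ). Consequently the function Q(ξ) = 1/(2 g(ξ,ξ)²) is a rational function of ξ. -/
open MeasureTheory

open Polynomial in
/-- Every complex polynomial has a polynomial antiderivative vanishing at the origin. -/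
lemma exists_polynomial_setIntegral (P : ℂ[X]) :
    ∃ A : ℂ[X], A.eval 0 = 0 ∧
      ∀ ξ : ℝ, 0 < ξ → ∫ t in Set.Ioo (0 : ℝ) ξ, P.eval (t : ℂ) = A.eval (ξ : ℂ) := by
  have hint (Q : ℂ[X]) (ξ : ℝ) :
      IntegrableOn (fun t : ℝ => Q.eval (t : ℂ)) (Set.Ioo (0 : ℝ) ξ) :=
    ((Q.continuous.comp Complex.continuous_ofReal).continuousOn.integrableOn_Icc
      (a := 0) (b := ξ)).mono_set Set.Ioo_subset_Icc_self
  induction P using Polynomial.induction_on' with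
  | add P Q hP hQ =>
    obtain ⟨A, hA0, hA⟩ := hP
    obtain ⟨B, hB0, hB⟩ := hQ
    refine ⟨A + B, by simp [hA0, hB0], fun ξ hξ => ?_⟩
    simp only [eval_add]
    rw [integral_add (hint P ξ) (hint Q ξ), hA ξ hξ, hB ξ hξ]
  | monomial n a =>
    refine ⟨monomial (n + 1) (a / (n + 1)), by simp, fun ξ hξ => ?_⟩
    simp only [eval_monomial]
    rw [← integral_Ioc_eq_integral_Ioo, ← intervalIntegral.integral_of_le hξ.le,
      intervalIntegral.integral_const_mul]
    have h : ∫ t in (0 : ℝ)..ξ, (t : ℂ) ^ n = ((∫ t in (0 : ℝ)..ξ, t ^ n : ℝ) : ℂ) := by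
      rw [← intervalIntegral.integral_ofReal]; simp
    rw [h, integral_pow]
    push_cast
    simp
    ring

open Polynomial in
/-- Polynomials are square integrable on bounded intervals. -/
lemma memLp_polynomial_Ioo (P : ℂ[X]) (ξ : ℝ) :
    MemLp (fun t : ℝ => P.eval (t : ℂ)) 2 (volume.restrict (Set.Ioo (0 : ℝ) ξ)) := by
  have hc : Continuous (fun t : ℝ => P.eval (t : ℂ)) :=
    P.continuous.comp Complex.continuous_ofReal
  obtain ⟨C, hC⟩ := (isCompact_Icc (a := (0 : ℝ)) (b := ξ)).exists_bound_of_continuousOn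
    hc.continuousOn
  refine MemLp.of_bound hc.aestronglyMeasurable C ?_
  filter_upwards [ae_restrict_mem measurableSet_Ioo] with t ht
  exact hC t (Set.Ioo_subset_Icc_self ht)

open Polynomial in
/-- A polynomial vanishing almost everywhere on a nonempty interval is zero. -/
lemma polynomial_eq_zero_of_ae_Ioo (P : ℂ[X]) {ξ : ℝ} (hξ : 0 < ξ)
    (h : ∀ᵐ t : ℝ ∂(volume.restrict (Set.Ioo (0 : ℝ) ξ)), P.eval (t : ℂ) = 0) : P = 0 := by
  by_contra hP
  have hfin : {t : ℝ | P.eval (t : ℂ) = 0}.Finite := by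
    refine Set.Finite.of_finite_image (f := fun t : ℝ => (t : ℂ)) ?_
      Complex.ofReal_injective.injOn
    refine P.roots.toFinset.finite_toSet.subset ?_
    rintro _ ⟨t, ht, rfl⟩
    simpa [hP] using ht
  have h1 : ∀ᵐ t : ℝ ∂(volume.restrict (Set.Ioo (0 : ℝ) ξ)), P.eval (t : ℂ) ≠ 0 :=
    ae_restrict_of_ae (measure_eq_zero_iff_ae_notMem.mp (hfin.measure_zero volume))
  have h2 : ∀ᵐ t : ℝ ∂(volume.restrict (Set.Ioo (0 : ℝ) ξ)), False := by
    filter_upwards [h, h1] with t ht ht'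
    exact ht' ht
  rw [ae_iff] at h2
  simp at h2
  linarith

open Polynomial in
/-- The translation kernel of a polynomial is separable. -/
lemma eval_sub_eq_sum_hasseDeriv (k : ℂ[X]) (x t : ℂ) :
    k.eval (x - t) = ∑ i : Fin (k.natDegree + 1),
      x ^ (i : ℕ) * ((hasseDeriv i k).comp (-X)).eval t := by
  have h : k.eval (x - t) = (taylor (-t) k).eval x := by
    rw [taylor_eval, sub_eq_add_neg]
  rw [h, eval_eq_sum_range, natDegree_taylor,
    Finset.sum_range (fun i => (taylor (-t) k).coeff i * x ^ i)]
  refine Finset.sum_congr rfl fun i _ => ?_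
  rw [taylor_coeff, eval_comp]
  simp [mul_comm]

open Polynomial in
/-- On square integrable functions, a polynomial convolution operator has finite rank. -/
lemma setIntegral_eval_sub_mul (k : ℂ[X]) (ξ x : ℝ) {f : ℝ → ℂ}
    (hf : MemLp f 2 (volume.restrict (Set.Ioo (0 : ℝ) ξ))) :
    ∫ t in Set.Ioo (0 : ℝ) ξ, k.eval ((x : ℂ) - (t : ℂ)) * f t =
      ∑ i : Fin (k.natDegree + 1), (x : ℂ) ^ (i : ℕ) *
        ∫ t in Set.Ioo (0 : ℝ) ξ, ((hasseDeriv i k).comp (-X)).eval (t : ℂ) * f t := by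
  simp only [eval_sub_eq_sum_hasseDeriv, Finset.sum_mul, mul_assoc]
  rw [integral_finsetSum]
  · simp only [integral_const_mul]
  · intro i _
    exact ((memLp_polynomial_Ioo _ ξ).integrable_mul hf).const_mul _

open Polynomial in
/-- The moments of a polynomial `∑ cₗ xˡ` against the `Pᵢ` depend on the coefficient vector `c`
through the matrix of moments of the `Pᵢ xˡ`. -/
lemma setIntegral_mul_sum_eq_mulVec {n : ℕ} (A : ℂ[X] → ℂ[X]) {ξ : ℝ}
    (hA : ∀ P : ℂ[X], ∫ t in Set.Ioo (0 : ℝ) ξ, P.eval (t : ℂ) = (A P).eval (ξ : ℂ))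
    (P : Fin n → ℂ[X]) (c : Fin n → ℂ) (i : Fin n) :
    ∫ t in Set.Ioo (0 : ℝ) ξ,
        (P i).eval (t : ℂ) * (∑ l : Fin n, C (c l) * X ^ (l : ℕ)).eval (t : ℂ) =
      (Matrix.of (fun i l : Fin n => (A (P i * X ^ (l : ℕ))).eval (ξ : ℂ))).mulVec c i := by
  have hint (Q : ℂ[X]) :
      Integrable (fun t : ℝ => Q.eval (t : ℂ)) (volume.restrict (Set.Ioo (0 : ℝ) ξ)) :=
    (memLp_polynomial_Ioo Q ξ).integrable (by norm_num)
  have h (t : ℝ) : (P i).eval (t : ℂ) * (∑ l : Fin n, C (c l) * X ^ (l : ℕ)).eval (t : ℂ) =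
      ∑ l : Fin n, c l * (P i * X ^ (l : ℕ)).eval (t : ℂ) := by
    simp only [eval_finsetSum, eval_mul, eval_C, Finset.mul_sum]
    exact Finset.sum_congr rfl fun l _ => by ring
  simp only [h]
  rw [integral_finsetSum _ fun l _ => (hint _).const_mul _]
  simp only [integral_const_mul, hA, Matrix.mulVec, dotProduct, Matrix.of_apply, mul_comm]

/- STATEMENT 15: For a polynomial kernel k (even, real on the real axis), there are
   polynomials p, q (q ≢ 0) such that for every ξ > 0 at which the operator
   (S_ξ f)(x) = f(x) + ∫₀^ξ k(x−t)f(t)dt is invertible on L²(0,ξ), the equation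
   g(x) + ∫₀^ξ k(x−t)g(t)dt = 1 has a unique solution g(·,ξ) in L²(0,ξ); the solution
   coincides (a.e.) with a polynomial in x, q(ξ) ≠ 0, and g(ξ,ξ) = p(ξ)/q(ξ).
   Consequently Q(ξ) = 1/(2 g(ξ,ξ)²) is a rational function of ξ. -/
theorem stmt_15 (m : ℕ) (k : Polynomial ℂ) (hdeg : k.natDegree = 2 * m)
    -- k(−x) = k(x) = conj(k(x)) on the real axis
    (heven : ∀ x : ℝ, k.eval (-(x : ℂ)) = k.eval (x : ℂ))
    (hreal : ∀ x : ℝ, (starRingEnd ℂ) (k.eval (x : ℂ)) = k.eval (x : ℂ))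
    -- the family of operators S_ξ on L²(0,ξ)
    (S : (ξ : ℝ) → Lp (α := ℝ) ℂ 2 (volume.restrict (Set.Ioo 0 ξ)) →L[ℂ]
      Lp (α := ℝ) ℂ 2 (volume.restrict (Set.Ioo 0 ξ)))
    (hS : ∀ ξ : ℝ, 0 < ξ → ∀ f : Lp (α := ℝ) ℂ 2 (volume.restrict (Set.Ioo 0 ξ)),
      ∀ᵐ x ∂(volume.restrict (Set.Ioo (0:ℝ) ξ)),
        (S ξ) f x = f x + ∫ t in Set.Ioo (0:ℝ) ξ, k.eval ((x : ℂ) - (t : ℂ)) * f t) :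
    ∃ p q : Polynomial ℂ, q ≠ 0 ∧
      ∀ ξ : ℝ, 0 < ξ → Function.Bijective (S ξ) →
        -- unique solvability of g(x) + ∫₀^ξ k(x−t)g(t)dt = 1 in L²(0,ξ)
        (∃! g : Lp (α := ℝ) ℂ 2 (volume.restrict (Set.Ioo 0 ξ)),
          ∀ᵐ x ∂(volume.restrict (Set.Ioo (0:ℝ) ξ)),
            g x + ∫ t in Set.Ioo (0:ℝ) ξ, k.eval ((x : ℂ) - (t : ℂ)) * g t = 1) ∧
        q.eval (ξ : ℂ) ≠ 0 ∧
        -- the solution coincides with a polynomial G, and g(ξ,ξ) = G(ξ) = p(ξ)/q(ξ)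
        (∀ g : Lp (α := ℝ) ℂ 2 (volume.restrict (Set.Ioo 0 ξ)),
          (∀ᵐ x ∂(volume.restrict (Set.Ioo (0:ℝ) ξ)),
            g x + ∫ t in Set.Ioo (0:ℝ) ξ, k.eval ((x : ℂ) - (t : ℂ)) * g t = 1) →
          ∃ G : Polynomial ℂ,
            (∀ᵐ x ∂(volume.restrict (Set.Ioo (0:ℝ) ξ)), g x = G.eval (x : ℂ)) ∧
            G.eval (ξ : ℂ) = p.eval (ξ : ℂ) / q.eval (ξ : ℂ)) := by
  classical
  choose A hA0 hA using exists_polynomial_setIntegral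
  set n := k.natDegree + 1 with hn
  let P : Fin n → Polynomial ℂ := fun i => (Polynomial.hasseDeriv i k).comp (-Polynomial.X)
  let M : Matrix (Fin n) (Fin n) (Polynomial ℂ) :=
    1 + Matrix.of fun i l : Fin n => A (P i * Polynomial.X ^ (l : ℕ))
  let b : Fin n → Polynomial ℂ := fun i => A (P i)
  have hMeval (z : ℂ) : (Polynomial.evalRingHom z).mapMatrix M =
      1 + Matrix.of fun i l : Fin n => (A (P i * Polynomial.X ^ (l : ℕ))).eval z := by
    rw [map_add, map_one]
    rfl
  refine ⟨M.det - ∑ i : Fin n, Polynomial.X ^ (i : ℕ) * M.adjugate.mulVec b i, M.det, ?_, ?_⟩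
  · intro h0
    have h1 : (Polynomial.evalRingHom 0) M.det = 1 := by
      rw [RingHom.map_det, hMeval]
      simp only [hA0]
      have : (Matrix.of fun _ _ => (0 : ℂ) : Matrix (Fin n) (Fin n) ℂ) = 0 := rfl
      rw [this, add_zero, Matrix.det_one]
    rw [h0] at h1
    simp at h1
  intro ξ hξ hbij
  have hsolve (f g : Lp (α := ℝ) ℂ 2 (volume.restrict (Set.Ioo 0 ξ))) (u : ℝ → ℂ)
      (hu : f =ᵐ[volume.restrict (Set.Ioo 0 ξ)] u) :
      (∀ᵐ x ∂(volume.restrict (Set.Ioo (0 : ℝ) ξ)),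
        g x + ∫ t in Set.Ioo (0 : ℝ) ξ, k.eval ((x : ℂ) - (t : ℂ)) * g t = u x) ↔
        S ξ g = f := by
    constructor
    · intro h
      refine Lp.ext ?_
      filter_upwards [h, hS ξ hξ g, hu] with x h1 h2 h3
      rw [h2, h1, h3]
    · rintro rfl
      filter_upwards [hS ξ hξ g, hu] with x h2 h3
      rw [← h2, h3]
  have hrank (g : Lp (α := ℝ) ℂ 2 (volume.restrict (Set.Ioo 0 ξ))) (x : ℝ) :
      ∫ t in Set.Ioo (0 : ℝ) ξ, k.eval ((x : ℂ) - (t : ℂ)) * g t =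
        ∑ i : Fin n, (x : ℂ) ^ (i : ℕ) *
          ∫ t in Set.Ioo (0 : ℝ) ξ, (P i).eval (t : ℂ) * g t :=
    setIntegral_eval_sub_mul k ξ x (Lp.memLp g)
  have hmom := setIntegral_mul_sum_eq_mulVec A (fun Q => hA Q ξ hξ) P
  have hdet : M.det.eval (ξ : ℂ) ≠ 0 := by
    intro h0
    have h0' : ((Polynomial.evalRingHom (ξ : ℂ)).mapMatrix M).det = 0 := by
      rw [← RingHom.map_det]; exact h0
    obtain ⟨c, hc, hMc⟩ := Matrix.exists_mulVec_eq_zero_iff.mpr h0'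
    rw [hMeval, Matrix.add_mulVec, Matrix.one_mulVec] at hMc
    set F : Polynomial ℂ := ∑ l : Fin n, Polynomial.C (c l) * Polynomial.X ^ (l : ℕ) with hF
    have hFL := (memLp_polynomial_Ioo F ξ).coeFn_toLp
    set f := (memLp_polynomial_Ioo F ξ).toLp with hf
    have hSf : S ξ f = 0 := by
      refine (hsolve 0 f 0 (Lp.coeFn_zero _ _ _)).mp ?_
      filter_upwards [hFL] with x hx
      rw [hrank, hx]
      have h1 (i : Fin n) : ∫ t in Set.Ioo (0 : ℝ) ξ, (P i).eval (t : ℂ) * f t = -c i := by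
        have h2 : ∫ t in Set.Ioo (0 : ℝ) ξ, (P i).eval (t : ℂ) * f t =
            ∫ t in Set.Ioo (0 : ℝ) ξ, (P i).eval (t : ℂ) * F.eval (t : ℂ) := by
          refine integral_congr_ae ?_
          filter_upwards [hFL] with t ht
          rw [ht]
        rw [h2, hmom c i]
        have h3 := congrFun hMc i
        simp only [Pi.add_apply, Pi.zero_apply] at h3
        exact eq_neg_of_add_eq_zero_right h3
      simp only [h1, hF, Polynomial.eval_finsetSum, Polynomial.eval_mul, Polynomial.eval_C,
        Polynomial.eval_pow, Polynomial.eval_X, Pi.zero_apply]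
      rw [← Finset.sum_add_distrib]
      exact Finset.sum_eq_zero fun i _ => by ring
    have hf0 : f = 0 := hbij.1 (by rw [hSf, map_zero])
    have hF0 : F = 0 := by
      refine polynomial_eq_zero_of_ae_Ioo F hξ ?_
      rw [hf0] at hFL
      filter_upwards [hFL, Lp.coeFn_zero ℂ 2 (volume.restrict (Set.Ioo (0 : ℝ) ξ))]
        with t h1 h2
      rw [← h1, h2, Pi.zero_apply]
    refine hc (funext fun i => ?_)
    have h4 := congrArg (fun Q => Q.coeff (i : ℕ)) hF0
    simpa [hF, Polynomial.coeff_X_pow, Fin.val_inj] using h4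
  have h1L : MemLp (fun _ : ℝ => (1 : ℂ)) 2 (volume.restrict (Set.Ioo 0 ξ)) :=
    memLp_const 1
  have hiff := fun g => hsolve h1L.toLp g (fun _ => 1) h1L.coeFn_toLp
  refine ⟨?_, hdet, fun g hg => ?_⟩
  · simp only [hiff]
    exact hbij.existsUnique _
  set c : Fin n → ℂ := fun i => ∫ t in Set.Ioo (0 : ℝ) ξ, (P i).eval (t : ℂ) * g t with hc
  set F : Polynomial ℂ := ∑ l : Fin n, Polynomial.C (c l) * Polynomial.X ^ (l : ℕ) with hF
  have hFeval (z : ℂ) : F.eval z = ∑ i : Fin n, z ^ (i : ℕ) * c i := by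
    simp only [hF, Polynomial.eval_finsetSum, Polynomial.eval_mul, Polynomial.eval_C,
      Polynomial.eval_pow, Polynomial.eval_X]
    exact Finset.sum_congr rfl fun i _ => mul_comm _ _
  have hgF : ∀ᵐ x ∂(volume.restrict (Set.Ioo (0 : ℝ) ξ)), g x = (1 - F).eval (x : ℂ) := by
    filter_upwards [hg] with x hx
    rw [hrank] at hx
    rw [Polynomial.eval_sub, Polynomial.eval_one, hFeval]
    exact eq_sub_of_add_eq hx
  refine ⟨1 - F, hgF, ?_⟩
  have hint (Q : Polynomial ℂ) :
      Integrable (fun t : ℝ => Q.eval (t : ℂ)) (volume.restrict (Set.Ioo (0 : ℝ) ξ)) :=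
    (memLp_polynomial_Ioo Q ξ).integrable (by norm_num)
  have hlin : ((Polynomial.evalRingHom (ξ : ℂ)).mapMatrix M).mulVec c =
      fun i => (b i).eval (ξ : ℂ) := by
    rw [hMeval, Matrix.add_mulVec, Matrix.one_mulVec]
    funext i
    rw [Pi.add_apply, ← hmom c i]
    have h1 : c i = ∫ t in Set.Ioo (0 : ℝ) ξ,
        ((P i).eval (t : ℂ) - (P i * F).eval (t : ℂ)) := by
      refine integral_congr_ae ?_
      filter_upwards [hgF] with t ht
      simp only [ht, Polynomial.eval_sub, Polynomial.eval_one, Polynomial.eval_mul]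
      ring
    rw [integral_sub (hint _) (hint _), hA _ ξ hξ] at h1
    rw [h1]
    simp only [Polynomial.eval_mul]
    exact sub_add_cancel _ _
  have hadj (i : Fin n) : (M.adjugate.mulVec b i).eval (ξ : ℂ) = M.det.eval (ξ : ℂ) * c i := by
    have h1 := congrArg
      (((Polynomial.evalRingHom (ξ : ℂ)).mapMatrix M).adjugate.mulVec ·) hlin
    simp only [Matrix.mulVec_mulVec, Matrix.adjugate_mul, Matrix.smul_mulVec,
      Matrix.one_mulVec] at h1
    rw [← RingHom.map_det, ← RingHom.map_adjugate] at h1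
    have h2 := congrFun h1 i
    have h3 := RingHom.map_mulVec (Polynomial.evalRingHom (ξ : ℂ)) M.adjugate b i
    exact h3.trans h2.symm
  rw [eq_div_iff hdet]
  simp only [Polynomial.eval_sub, Polynomial.eval_one, hFeval, Polynomial.eval_finsetSum,
    Polynomial.eval_mul, Polynomial.eval_pow, Polynomial.eval_X, hadj]
  rw [sub_mul, one_mul, Finset.sum_mul]
  congr 1
  exact Finset.sum_congr rfl fun i _ => by ring
end

section
/- The operator S admits a triangular factorization: there exists a bounded invertible operator S₋ on L²(0,a) with bounded inverse such that S = S₋ S₋* and, for every ξ ∈ [0,a], Q_ξ S₋ Q_ξ = Q_ξ S₋ and Q_ξ S₋^{−1} Q_ξ = Q_ξ S₋^{−1}. -/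
open MeasureTheory

namespace SineKernel

open scoped InnerProductSpace Topology ENNReal FourierTransform SchwartzMap

variable {a : ℝ}

/-- Lebesgue measure on `(0, a)`. -/
noncomputable abbrev vol (a : ℝ) : Measure ℝ := volume.restrict (Set.Ioo 0 a)

/-- The Hilbert space `L²(0, a)`. -/
abbrev L2I (a : ℝ) : Type := Lp (α := ℝ) ℂ 2 (volume.restrict (Set.Ioo 0 a))

lemma norm_sq_eq_integral {μ : Measure ℝ} (f : Lp (α := ℝ) ℂ 2 μ) :
    ‖f‖ ^ 2 = ∫ x, ‖f x‖ ^ 2 ∂μ := by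
  have h := @inner_self_eq_norm_sq_to_K ℂ _ _ _ _ f
  rw [L2.inner_def] at h
  simp only [inner_self_eq_norm_sq_to_K] at h
  have h2 : (∫ x, ((‖f x‖ : ℂ)) ^ 2 ∂μ) = ((∫ x, ‖f x‖ ^ 2 ∂μ : ℝ) : ℂ) := by
    rw [← integral_complex_ofReal]; simp
  simp only [Complex.coe_algebraMap] at h
  rw [h2] at h
  exact_mod_cast h.symm

lemma integrable_norm_sq (f : L2I a) : Integrable (fun x => ‖f x‖ ^ 2) (vol a) :=
  (memLp_two_iff_integrable_sq_norm (Lp.aestronglyMeasurable f)).1 (Lp.memLp f)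

lemma memLp_indicator_Ioi (ξ : ℝ) (f : L2I a) : MemLp ((Set.Ioi ξ).indicator f) 2 (vol a) :=
  (Lp.memLp f).indicator measurableSet_Ioi

/-- The linear map underlying `cut`. -/
noncomputable def cutₗ (ξ : ℝ) : L2I a →ₗ[ℂ] L2I a where
  toFun f := (memLp_indicator_Ioi ξ f).toLp _
  map_add' f g := by
    rw [← MemLp.toLp_add]
    apply MemLp.toLp_congr
    filter_upwards [Lp.coeFn_add f g] with x hx
    by_cases h : x ∈ Set.Ioi ξ
    · simp only [Pi.add_apply, Set.indicator_of_mem h]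
      exact hx
    · simp only [Pi.add_apply, Set.indicator_of_notMem h, add_zero]
  map_smul' c f := by
    rw [RingHom.id_apply, ← MemLp.toLp_const_smul]
    apply MemLp.toLp_congr
    filter_upwards [Lp.coeFn_smul c f] with x hx
    by_cases h : x ∈ Set.Ioi ξ
    · simp only [Pi.smul_apply, Set.indicator_of_mem h]
      exact hx
    · simp only [Pi.smul_apply, Set.indicator_of_notMem h, smul_zero]

lemma cutₗ_ae (ξ : ℝ) (f : L2I a) :
    ∀ᵐ x ∂(vol a), (cutₗ ξ f : L2I a) x = if ξ < x then f x else 0 := by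
  filter_upwards [MemLp.coeFn_toLp (memLp_indicator_Ioi ξ f)] with x hx
  exact hx

/-- Multiplication by the indicator function of `(ξ, ∞)` on `L²(0, a)`. -/
noncomputable def cut (ξ : ℝ) : L2I a →L[ℂ] L2I a :=
  (cutₗ ξ).mkContinuous 1 fun f => by
    rw [one_mul]
    apply Lp.norm_le_norm_of_ae_le
    filter_upwards [cutₗ_ae ξ f] with x hx
    rw [hx]
    split_ifs <;> simp

lemma cut_ae (ξ : ℝ) (f : L2I a) : ∀ᵐ x ∂(vol a), cut ξ f x = if ξ < x then f x else 0 :=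
  cutₗ_ae ξ f

lemma norm_cut_le (ξ : ℝ) (f : L2I a) : ‖cut ξ f‖ ≤ ‖f‖ := by
  apply Lp.norm_le_norm_of_ae_le
  filter_upwards [cut_ae ξ f] with x hx
  rw [hx]
  split_ifs <;> simp

lemma cut_cut (ξ η : ℝ) (f : L2I a) : cut ξ (cut η f) = cut (max ξ η) f := by
  apply Lp.ext
  filter_upwards [cut_ae ξ (cut η f), cut_ae η f, cut_ae (max ξ η) f] with x h1 h2 h3
  rw [h1, h2, h3]
  by_cases p : ξ < x <;> by_cases q : η < x <;> simp [p, q]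

lemma cut_idem (ξ : ℝ) (f : L2I a) : cut ξ (cut ξ f) = cut ξ f := by
  rw [cut_cut, max_self]

lemma inner_cut (ξ : ℝ) (f g : L2I a) : ⟪cut ξ f, g⟫_ℂ = ⟪f, cut ξ g⟫_ℂ := by
  rw [L2.inner_def, L2.inner_def]
  apply integral_congr_ae
  filter_upwards [cut_ae ξ f, cut_ae ξ g] with x h1 h2
  rw [h1, h2]
  split_ifs <;> simp

lemma adjoint_cut (ξ : ℝ) : ContinuousLinearMap.adjoint (cut (a := a) ξ) = cut ξ := by
  symm
  rw [ContinuousLinearMap.eq_adjoint_iff]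
  exact fun f g => inner_cut ξ f g

lemma cut_nonpos (ξ : ℝ) (hξ : ξ ≤ 0) (f : L2I a) : cut ξ f = f := by
  apply Lp.ext
  filter_upwards [cut_ae ξ f, ae_restrict_mem measurableSet_Ioo] with x h1 h2
  rw [h1, if_pos (hξ.trans_lt h2.1)]

lemma cut_ge (ξ : ℝ) (hξ : a ≤ ξ) (f : L2I a) : cut ξ f = 0 := by
  apply Lp.ext
  filter_upwards [cut_ae ξ f, ae_restrict_mem measurableSet_Ioo,
    Lp.coeFn_zero ℂ 2 (vol a)] with x h1 h2 h3
  rw [h1, if_neg (by have := h2.2; linarith), h3]; rfl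

lemma norm_sq_cut_sub (ξ η : ℝ) (h : ξ ≤ η) (f : L2I a) :
    ‖(cut ξ - cut η : L2I a →L[ℂ] L2I a) f‖ ^ 2 = ‖cut ξ f‖ ^ 2 - ‖cut η f‖ ^ 2 := by
  have h1 : ⟪cut ξ f, cut η f⟫_ℂ = ⟪cut η f, cut η f⟫_ℂ := by
    rw [← inner_cut, ← inner_cut, cut_cut, cut_cut, max_eq_left h, max_self]
  rw [sub_apply, @norm_sub_sq ℂ, h1, inner_self_eq_norm_sq]
  ring

/-- `T` maps `L²(0, a)` boundedly into `L^∞(0, a)`, with bound `M`. -/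
def LInfBounded (M : ℝ) (T : L2I a →L[ℂ] L2I a) : Prop :=
  ∀ f : L2I a, ∀ᵐ x ∂(vol a), ‖T f x‖ ≤ M * ‖f‖

/-- `T` leaves every subspace `L²(0, ξ)` invariant. -/
def Upper (T : L2I a →L[ℂ] L2I a) : Prop := ∀ ξ f, cut ξ (T (cut ξ f)) = cut ξ (T f)

/-- `T` leaves every subspace `L²(ξ, a)` invariant. -/
def Lower (T : L2I a →L[ℂ] L2I a) : Prop := ∀ ξ f, cut ξ (T (cut ξ f)) = T (cut ξ f)

lemma norm_sq_cut_sub_le {M : ℝ} {ξ η : ℝ} (h : ξ ≤ η) (h0 : L2I a)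
    (hb : ∀ᵐ x ∂(vol a), ‖h0 x‖ ≤ M) :
    ‖(cut ξ - cut η : L2I a →L[ℂ] L2I a) h0‖ ^ 2 ≤ M ^ 2 * (η - ξ) := by
  rw [norm_sq_eq_integral]
  have key : ∀ᵐ x ∂(vol a), ‖((cut ξ - cut η : L2I a →L[ℂ] L2I a) h0) x‖ ^ 2 ≤
      (Set.Ioc ξ η).indicator (fun _ => M ^ 2) x := by
    rw [sub_apply]
    filter_upwards [cut_ae ξ h0, cut_ae η h0, Lp.coeFn_sub (cut ξ h0) (cut η h0), hb]
      with x h1 h2 h3 h4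
    rw [h3, Pi.sub_apply, h1, h2]
    have h5 : ‖h0 x‖ ^ 2 ≤ M ^ 2 := by gcongr
    by_cases p : ξ < x <;> by_cases q : η < x <;>
      simp [Set.indicator, p, q, h5, not_le.2, not_lt.1]
    linarith
  have hint : Integrable ((Set.Ioc ξ η).indicator (fun _ => M ^ 2)) volume :=
    (integrable_indicator_iff measurableSet_Ioc).2 (integrableOn_const measure_Ioc_lt_top.ne)
  calc _ ≤ ∫ x, (Set.Ioc ξ η).indicator (fun _ => M ^ 2) x ∂(vol a) :=
        integral_mono_ae (integrable_norm_sq _) hint.restrict key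
    _ ≤ ∫ x, (Set.Ioc ξ η).indicator (fun _ => M ^ 2) x :=
        setIntegral_le_integral hint (Filter.Eventually.of_forall fun x =>
          Set.indicator_nonneg (fun _ _ => sq_nonneg M) x)
    _ = _ := by
        rw [integral_indicator measurableSet_Ioc]
        simp [h, mul_comm]

lemma LInfBounded.sub {M N : ℝ} {S T : L2I a →L[ℂ] L2I a} (hS : LInfBounded M S)
    (hT : LInfBounded N T) : LInfBounded (M + N) (S - T) := by
  intro f
  rw [sub_apply]
  filter_upwards [hS f, hT f, Lp.coeFn_sub (S f) (T f)] with x h1 h2 h3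
  rw [h3, Pi.sub_apply, add_mul]
  exact (norm_sub_le _ _).trans (add_le_add h1 h2)

lemma LInfBounded.mul {M : ℝ} (hM : 0 ≤ M) {T : L2I a →L[ℂ] L2I a} (hT : LInfBounded M T)
    (A : L2I a →L[ℂ] L2I a) : LInfBounded (M * ‖A‖) (T * A) := by
  intro f
  filter_upwards [hT (A f)] with x h1
  refine h1.trans ?_
  rw [mul_assoc]
  exact mul_le_mul_of_nonneg_left (A.le_opNorm f) hM

lemma LInfBounded.norm_sq_cut_sub_le {M : ℝ} {T : L2I a →L[ℂ] L2I a} (hT : LInfBounded M T)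
    {ξ η : ℝ} (h : ξ ≤ η) (f : L2I a) :
    ‖(cut ξ - cut η : L2I a →L[ℂ] L2I a) (T f)‖ ^ 2 ≤ (M * ‖f‖) ^ 2 * (η - ξ) :=
  SineKernel.norm_sq_cut_sub_le h _ (hT f)

lemma LInfBounded.ae_le_of_upper {M : ℝ} {T : L2I a →L[ℂ] L2I a} (hT : LInfBounded M T)
    (hU : Upper T) (f : L2I a) :
    ∀ᵐ x ∂(vol a), ∀ q : ℚ, (q : ℝ) < x → ‖T f x‖ ≤ M * ‖cut (q : ℝ) f‖ := by
  rw [ae_all_iff]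
  intro q
  have h := hU q f
  filter_upwards [cut_ae (q : ℝ) (T f), cut_ae (q : ℝ) (T (cut (q : ℝ) f)), hT (cut (q : ℝ) f)]
    with x h1 h2 h3 hq
  rw [h, h1, if_pos hq, if_pos hq] at h2
  rwa [h2]

lemma integral_sub_pow_div (ξ : ℝ) (n : ℕ) (C : ℝ) :
    ∫ x in ξ..a, C * ((a - x) ^ n / n.factorial) =
      C * ((a - ξ) ^ (n + 1) / (n + 1).factorial) := by
  rw [intervalIntegral.integral_const_mul, intervalIntegral.integral_div,
    intervalIntegral.integral_comp_sub_left (fun x => x ^ n) a, integral_pow, Nat.factorial_succ]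
  push_cast
  simp only [sub_self, ne_eq, Nat.add_eq_zero_iff, one_ne_zero, and_false, not_false_eq_true,
    zero_pow, sub_zero]
  rw [div_div]

/-- The iteration step for Volterra operators. -/
lemma volterra_step {M : ℝ} {T : L2I a →L[ℂ] L2I a} (hT : LInfBounded M T)
    (hU : Upper T) (f : L2I a) (C : ℝ) (n : ℕ)
    (hf : ∀ ξ ∈ Set.Icc 0 a, ‖cut ξ f‖ ^ 2 ≤ C * ((a - ξ) ^ n / n.factorial)) :
    ∀ ξ ∈ Set.Icc 0 a, ‖cut ξ (T f)‖ ^ 2 ≤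
      (M ^ 2 * C) * ((a - ξ) ^ (n + 1) / (n + 1).factorial) := by
  intro ξ hξ
  set F : ℝ → ℝ := fun x => (M ^ 2 * C) * ((a - x) ^ n / n.factorial) with hF
  have hFc : Continuous F := by fun_prop
  have key : ∀ᵐ x ∂(vol a), ‖T f x‖ ^ 2 ≤ F x := by
    filter_upwards [hT.ae_le_of_upper hU f, ae_restrict_mem measurableSet_Ioo] with x hx hxa
    by_contra! hlt
    obtain ⟨δ, hδ, hball⟩ := Metric.eventually_nhds_iff.1 (hFc.continuousAt.eventually_lt_const hlt)
    obtain ⟨q, hq1, hq2⟩ := exists_rat_btwn (max_lt hxa.1 (sub_lt_self x hδ))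
    have h0 : 0 < (q : ℝ) := (le_max_left _ _).trans_lt hq1
    have h1 : x - δ < (q : ℝ) := (le_max_right _ _).trans_lt hq1
    have h2 := hball (y := q) (by rw [Real.dist_eq, abs_lt]; constructor <;> linarith)
    have h3 := hf q ⟨h0.le, hq2.le.trans hxa.2.le⟩
    have h4 : ‖T f x‖ ^ 2 ≤ (M * ‖cut (q : ℝ) f‖) ^ 2 := by gcongr; exact hx q hq2
    have h5 : (M * ‖cut (q : ℝ) f‖) ^ 2 ≤ F q := by
      calc _ = M ^ 2 * ‖cut (q : ℝ) f‖ ^ 2 := mul_pow _ _ _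
        _ ≤ M ^ 2 * (C * ((a - q) ^ n / n.factorial)) := by gcongr
        _ = _ := (mul_assoc _ _ _).symm
    linarith
  have hFnn : ∀ᵐ x ∂(vol a), 0 ≤ F x := by
    filter_upwards [key] with x hx using (sq_nonneg _).trans hx
  have hset : Set.Ioo 0 a ∩ Set.Ioi ξ = Set.Ioo ξ a := by
    ext x
    simp only [Set.mem_inter_iff, Set.mem_Ioo, Set.mem_Ioi]
    constructor
    · rintro ⟨⟨_, h⟩, h'⟩; exact ⟨h', h⟩
    · rintro ⟨h, h'⟩; exact ⟨⟨hξ.1.trans_lt h, h'⟩, h⟩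
  rw [norm_sq_eq_integral, ← integral_sub_pow_div, intervalIntegral.integral_of_le hξ.2,
    integral_Ioc_eq_integral_Ioo, ← hset, ← setIntegral_indicator measurableSet_Ioi]
  apply integral_mono_ae (integrable_norm_sq _)
  · exact ((hFc.integrableOn_Icc (a := 0) (b := a)).mono_set Set.Ioo_subset_Icc_self).indicator
      measurableSet_Ioi
  · filter_upwards [key, cut_ae ξ (T f)] with x h1 h2
    rw [h2]
    by_cases h : ξ < x
    · rw [if_pos h, Set.indicator_of_mem (by exact h)]
      exact h1
    · rw [if_neg h, Set.indicator_of_notMem (by exact h)]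
      simp

lemma norm_sq_cut_pow_le {M : ℝ} {T : L2I a →L[ℂ] L2I a} (hT : LInfBounded M T)
    (hU : Upper T) (f : L2I a) (n : ℕ) :
    ∀ ξ ∈ Set.Icc 0 a, ‖cut ξ ((T ^ n) f)‖ ^ 2 ≤
      ((M ^ 2) ^ n * ‖f‖ ^ 2) * ((a - ξ) ^ n / n.factorial) := by
  induction n with
  | zero =>
    intro ξ _
    have := norm_cut_le ξ f
    simp only [pow_zero, one_mul, Nat.factorial_zero, Nat.cast_one, div_one, mul_one]
    exact pow_le_pow_left₀ (norm_nonneg _) this 2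
  | succ n ih =>
    intro ξ hξ
    have := volterra_step hT hU _ _ n ih ξ hξ
    rw [pow_succ' T, mul_apply_eq_comp]
    refine this.trans (le_of_eq ?_)
    ring

/-- A Volterra operator has a power of norm less than one. -/
lemma exists_norm_pow_lt_one (ha : 0 < a) {M : ℝ} {T : L2I a →L[ℂ] L2I a} (hT : LInfBounded M T)
    (hU : Upper T) : ∃ n : ℕ, ‖T ^ n‖ < 1 := by
  have hlim := FloorSemiring.tendsto_pow_div_factorial_atTop (M ^ 2 * a)
  obtain ⟨n, hn⟩ := (hlim.eventually_lt_const (show (0 : ℝ) < 1 / 4 by norm_num)).exists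
  refine ⟨n, ?_⟩
  suffices ‖T ^ n‖ ≤ 1 / 2 by linarith
  refine ContinuousLinearMap.opNorm_le_bound _ (by norm_num) fun f => ?_
  have h := norm_sq_cut_pow_le hT hU f n 0 ⟨le_rfl, ha.le⟩
  rw [cut_nonpos 0 le_rfl, sub_zero] at h
  have h2 : ‖(T ^ n) f‖ ^ 2 ≤ (1 / 2 * ‖f‖) ^ 2 := by
    calc _ ≤ _ := h
      _ = ((M ^ 2 * a) ^ n / n.factorial) * ‖f‖ ^ 2 := by rw [mul_pow]; ring
      _ ≤ 1 / 4 * ‖f‖ ^ 2 := by gcongr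
      _ = _ := by ring
  exact (pow_le_pow_iff_left₀ (norm_nonneg _) (by positivity) two_ne_zero).1 h2

/-- The algebra of operators leaving every `L²(0, ξ)` invariant. -/
noncomputable def upperSubalgebra (a : ℝ) : Subalgebra ℂ (L2I a →L[ℂ] L2I a) where
  carrier := {T | Upper T}
  mul_mem' {S T} hS hT ξ f := by
    rw [mul_apply_eq_comp, mul_apply_eq_comp, ← hS, hT, hS]
  add_mem' {S T} hS hT ξ f := by
    rw [add_apply, add_apply, map_add, map_add, hS ξ f, hT ξ f]
  algebraMap_mem' c ξ f := by
    simp [Algebra.algebraMap_eq_smul_one, cut_idem]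

lemma isClosed_upperSubalgebra : IsClosed (upperSubalgebra a : Set (L2I a →L[ℂ] L2I a)) := by
  have : (upperSubalgebra a : Set (L2I a →L[ℂ] L2I a)) =
      ⋂ ξ : ℝ, ⋂ f : L2I a, {T | cut ξ (T (cut ξ f)) = cut ξ (T f)} := by
    ext T; simp [upperSubalgebra, Upper]
  rw [this]
  refine isClosed_iInter fun ξ => isClosed_iInter fun f => isClosed_eq ?_ ?_ <;> fun_prop

lemma isUnit_one_add_of_norm_pow_lt_one {R : Type*} [NormedRing R] [CompleteSpace R] {x : R}
    {n : ℕ} (h : ‖x ^ n‖ < 1) : IsUnit (1 + x) := by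
  have h1 : ‖(-x) ^ n‖ < 1 := by
    rcases n.even_or_odd with h' | h' <;> simpa [h'.neg_pow] using h
  have h2 : IsUnit (1 - (-x) ^ n) := isUnit_one_sub_of_norm_lt_one h1
  have hc : Commute (1 - (-x)) (∑ i ∈ Finset.range n, (-x) ^ i) := by
    rw [Commute, SemiconjBy, mul_neg_geom_sum, geom_sum_mul_neg]
  rw [← mul_neg_geom_sum, hc.isUnit_mul_iff, sub_neg_eq_add] at h2
  exact h2.1

/-- `1 + T` is invertible within the upper triangular operators when `T` is Volterra. -/
lemma exists_upper_inverse (ha : 0 < a) {M : ℝ} {T : L2I a →L[ℂ] L2I a} (hT : LInfBounded M T)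
    (hU : Upper T) : ∃ U : L2I a →L[ℂ] L2I a, Upper U ∧ (1 + T) * U = 1 ∧ U * (1 + T) = 1 := by
  obtain ⟨n, hn⟩ := exists_norm_pow_lt_one ha hT hU
  have : CompleteSpace (upperSubalgebra a) := isClosed_upperSubalgebra.completeSpace_coe
  let t : upperSubalgebra a := ⟨T, hU⟩
  obtain ⟨u, hu⟩ := isUnit_one_add_of_norm_pow_lt_one (x := t) (n := n) hn
  refine ⟨((u⁻¹ : (upperSubalgebra a)ˣ) : upperSubalgebra a), Subtype.prop _, ?_, ?_⟩
  · exact congrArg Subtype.val (show (1 + t) * ↑u⁻¹ = 1 by rw [← hu, Units.mul_inv])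
  · exact congrArg Subtype.val (show ↑u⁻¹ * (1 + t) = 1 by rw [← hu, Units.inv_mul])

/-- An operator commuting with all truncations, and splitting as an operator bounded into `L^∞`
plus the adjoint of such an operator, vanishes. -/
lemma eq_zero_of_commute_cut (ha : 0 < a) {M N : ℝ} {T B C : L2I a →L[ℂ] L2I a}
    (hB : LInfBounded M B) (hC : LInfBounded N C)
    (hT : T = B + ContinuousLinearMap.adjoint C)
    (hcomm : ∀ ξ f, cut ξ (T f) = T (cut ξ f)) : T = 0 := by
  have hnorm : ∀ ξ η : ℝ, ξ ≤ η → ∀ f : L2I a,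
      ‖(cut ξ - cut η : L2I a →L[ℂ] L2I a) (ContinuousLinearMap.adjoint C
        ((cut ξ - cut η : L2I a →L[ℂ] L2I a) f))‖ ^ 2 ≤
      N ^ 2 * (η - ξ) * ‖(cut ξ - cut η : L2I a →L[ℂ] L2I a) f‖ ^ 2 := by
    intro ξ η h f
    set D : L2I a →L[ℂ] L2I a := cut ξ - cut η with hD
    have hDadj : ContinuousLinearMap.adjoint D = D := by
      rw [hD, map_sub, adjoint_cut, adjoint_cut]
    have hDC : ‖D * C‖ ≤ |N| * √(η - ξ) := by
      refine ContinuousLinearMap.opNorm_le_bound _ (by positivity) fun g => ?_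
      have := hC.norm_sq_cut_sub_le h g
      apply (pow_le_pow_iff_left₀ (norm_nonneg _) (by positivity) two_ne_zero).1
      rw [mul_pow, mul_pow, Real.sq_sqrt (by linarith), sq_abs]
      refine this.trans (le_of_eq (by ring))
    have hnD : ∀ g, ‖D g‖ ≤ ‖g‖ := fun g => by
      apply (pow_le_pow_iff_left₀ (norm_nonneg _) (norm_nonneg _) two_ne_zero).1
      rw [hD, norm_sq_cut_sub _ _ h]
      have := pow_le_pow_left₀ (norm_nonneg _) (norm_cut_le ξ g) 2
      nlinarith [sq_nonneg ‖cut η g‖]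
    have hDD : D (D f) = D f := by
      simp only [hD, sub_apply, map_sub, cut_cut, max_self, max_eq_right h, max_eq_left h]
      abel
    have hadj : ContinuousLinearMap.adjoint C (D f) =
        (ContinuousLinearMap.adjoint (D * C)) (D f) := by
      rw [ContinuousLinearMap.mul_def, ContinuousLinearMap.adjoint_comp, hDadj,
        ContinuousLinearMap.comp_apply, hDD]
    have h3 : ‖ContinuousLinearMap.adjoint C (D f)‖ ≤ (|N| * √(η - ξ)) * ‖D f‖ := by
      rw [hadj]
      refine (ContinuousLinearMap.le_opNorm _ _).trans ?_
      rw [LinearIsometryEquiv.norm_map]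
      gcongr
    calc _ ≤ ((|N| * √(η - ξ)) * ‖D f‖) ^ 2 := by gcongr; exact (hnD _).trans h3
      _ = _ := by rw [mul_pow, mul_pow, Real.sq_sqrt (by linarith), sq_abs]
  have hstep : ∀ ξ η : ℝ, ξ ≤ η → ∀ f : L2I a,
      ‖cut ξ (T f)‖ ^ 2 - ‖cut η (T f)‖ ^ 2 ≤
        (2 * (M ^ 2 + N ^ 2)) * (η - ξ) * (‖cut ξ f‖ ^ 2 - ‖cut η f‖ ^ 2) := by
    intro ξ η h f
    rw [← norm_sq_cut_sub _ _ h, ← norm_sq_cut_sub _ _ h]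
    have h1 := hnorm ξ η h f
    set D : L2I a →L[ℂ] L2I a := cut ξ - cut η with hD
    have hDD : D (T f) = D (T (D f)) := by
      simp only [hD, sub_apply, map_sub, hcomm, cut_cut, max_self, max_eq_right h, max_eq_left h]
      abel
    have h2 := hB.norm_sq_cut_sub_le h (D f)
    rw [← hD] at h2
    have h3 : ‖D (T f)‖ ≤ ‖D (B (D f))‖ + ‖D (ContinuousLinearMap.adjoint C (D f))‖ := by
      rw [hDD, hT, add_apply, map_add]
      exact norm_add_le _ _
    calc ‖D (T f)‖ ^ 2 ≤ (‖D (B (D f))‖ + ‖D (ContinuousLinearMap.adjoint C (D f))‖) ^ 2 := by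
          gcongr
      _ ≤ 2 * (‖D (B (D f))‖ ^ 2 + ‖D (ContinuousLinearMap.adjoint C (D f))‖ ^ 2) := add_sq_le
      _ ≤ 2 * ((M * ‖D f‖) ^ 2 * (η - ξ) + N ^ 2 * (η - ξ) * ‖D f‖ ^ 2) := by gcongr
      _ = _ := by ring
  ext1 f
  set c := 2 * (M ^ 2 + N ^ 2) with hc
  have hbound : ∀ n : ℕ, ‖T f‖ ^ 2 ≤ c * a * ‖f‖ ^ 2 * (1 / ((n : ℝ) + 1)) := by
    intro n
    have hn : (0 : ℝ) < n + 1 := by positivity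
    let p : ℕ → ℝ := fun j => j * (a / (n + 1))
    have hp : ∀ j, p (j + 1) - p j = a / (n + 1) := fun j => by simp [p]; ring
    have hp0 : p 0 = 0 := by simp [p]
    have hpn : p (n + 1) = a := by simp [p]; field_simp
    have hsum : ∀ g : L2I a, ‖g‖ ^ 2 =
        ∑ j ∈ Finset.range (n + 1), (‖cut (p j) g‖ ^ 2 - ‖cut (p (j + 1)) g‖ ^ 2) := by
      intro g
      rw [Finset.sum_range_sub' (fun j => ‖cut (p j) g‖ ^ 2), hp0, hpn, cut_nonpos 0 le_rfl,
        cut_ge a le_rfl]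
      simp
    rw [hsum (T f)]
    calc _ ≤ ∑ j ∈ Finset.range (n + 1), c * (a / (n + 1)) *
          (‖cut (p j) f‖ ^ 2 - ‖cut (p (j + 1)) f‖ ^ 2) := by
          refine Finset.sum_le_sum fun j _ => ?_
          have := hstep (p j) (p (j + 1)) (by
            have := hp j; have : 0 < a / (n + 1) := by positivity
            linarith) f
          rwa [hp j] at this
      _ = _ := by rw [← Finset.mul_sum, ← hsum f]; ring
  have hlim : Filter.Tendsto (fun n : ℕ => c * a * ‖f‖ ^ 2 * (1 / ((n : ℝ) + 1)))
      Filter.atTop (𝓝 (c * a * ‖f‖ ^ 2 * 0)) :=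
    tendsto_one_div_add_atTop_nhds_zero_nat.const_mul _
  rw [mul_zero] at hlim
  have h0 : ‖T f‖ ^ 2 ≤ 0 := ge_of_tendsto' hlim hbound
  have : ‖T f‖ = 0 := by nlinarith [norm_nonneg (T f)]
  simpa using this

/-- `T` is the integral operator `(T f)(x) = ⟪g x, f⟫`. -/
def HasRows (T : L2I a →L[ℂ] L2I a) (g : ℝ → L2I a) : Prop :=
  ∀ f : L2I a, ∀ᵐ x ∂(vol a), T f x = ⟪g x, f⟫_ℂ

lemma exists_norm_bound {g : ℝ → L2I a} (hg : Continuous g) :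
    ∃ M : ℝ, 0 ≤ M ∧ ∀ᵐ x ∂(vol a), ‖g x‖ ≤ M := by
  obtain ⟨M, hM⟩ := (isCompact_Icc (a := (0 : ℝ)) (b := a)).exists_bound_of_continuousOn
    hg.continuousOn
  refine ⟨max M 0, le_max_right _ _, ?_⟩
  filter_upwards [ae_restrict_mem measurableSet_Ioo] with x hx
  exact (hM x (Set.Ioo_subset_Icc_self hx)).trans (le_max_left _ _)

lemma HasRows.linfBounded {T : L2I a →L[ℂ] L2I a} {g : ℝ → L2I a} (h : HasRows T g) {M : ℝ}
    (hM : ∀ᵐ x ∂(vol a), ‖g x‖ ≤ M) : LInfBounded M T := by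
  intro f
  filter_upwards [h f, hM] with x h1 h2
  rw [h1]
  exact (norm_inner_le_norm _ _).trans (by gcongr)

lemma exists_hasRows {g : ℝ → L2I a} (hg : Continuous g) :
    ∃ T : L2I a →L[ℂ] L2I a, HasRows T g := by
  obtain ⟨M, hM0, hM⟩ := exists_norm_bound hg
  have hbd : ∀ f : L2I a, ∀ᵐ x ∂(vol a), ‖⟪g x, f⟫_ℂ‖ ≤ M * ‖f‖ := fun f => by
    filter_upwards [hM] with x hx
    exact (norm_inner_le_norm _ _).trans (by gcongr)
  have hmem : ∀ f : L2I a, MemLp (fun x => ⟪g x, f⟫_ℂ) 2 (vol a) := fun f =>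
    MemLp.of_bound (by fun_prop) _ (hbd f)
  let L : L2I a →ₗ[ℂ] L2I a :=
    { toFun := fun f => (hmem f).toLp _
      map_add' := fun f f' => by
        rw [← MemLp.toLp_add]
        exact MemLp.toLp_congr _ _ (.of_forall fun x => inner_add_right _ _ _)
      map_smul' := fun c f => by
        rw [RingHom.id_apply, ← MemLp.toLp_const_smul]
        exact MemLp.toLp_congr _ _ (.of_forall fun x => inner_smul_right _ _ _) }
  have hL : ∀ f, ∀ᵐ x ∂(vol a), L f x = ⟪g x, f⟫_ℂ := fun f => MemLp.coeFn_toLp (hmem f)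
  refine ⟨L.mkContinuous ((measureUnivNNReal (vol a)) ^ ((2 : ℝ≥0∞).toReal)⁻¹ * M) fun f => ?_, hL⟩
  rw [mul_assoc]
  apply Lp.norm_le_of_ae_bound (by positivity)
  filter_upwards [hL f, hbd f] with x h1 h2
  rwa [h1]

lemma continuous_norm_sq_cut (f : L2I a) : Continuous fun ξ => ‖cut ξ f‖ ^ 2 := by
  have h : (fun ξ => ‖cut ξ f‖ ^ 2) =
      fun ξ => ∫ x, (if ξ < x then ‖f x‖ ^ 2 else 0) ∂(vol a) := by
    ext ξ
    rw [norm_sq_eq_integral]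
    apply integral_congr_ae
    filter_upwards [cut_ae ξ f] with x hx
    rw [hx]
    split_ifs <;> simp
  rw [h, continuous_iff_continuousAt]
  intro ξ
  apply continuousAt_of_dominated (bound := fun x => ‖f x‖ ^ 2)
  · refine .of_forall fun η => ?_
    exact ((integrable_norm_sq f).aestronglyMeasurable.indicator
      (measurableSet_Ioi (a := η))).congr (.of_forall fun x => by simp [Set.indicator])
  · refine .of_forall fun η => .of_forall fun x => ?_
    split_ifs <;> simp
  · exact integrable_norm_sq f
  · have : ∀ᵐ x ∂(vol a), x ≠ ξ := compl_mem_ae_iff.2 (measure_singleton ξ)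
    filter_upwards [this] with x hx
    rcases lt_or_gt_of_ne hx with h | h
    · refine continuousAt_const.congr (f := fun _ => (0 : ℝ)) ?_
      filter_upwards [lt_mem_nhds h] with η hη
      rw [if_neg (not_lt.2 hη.le)]
    · refine continuousAt_const.congr (f := fun _ => ‖f x‖ ^ 2) ?_
      filter_upwards [gt_mem_nhds h] with η hη
      rw [if_pos hη]

lemma norm_sq_cut_sub_abs (ξ η : ℝ) (f : L2I a) :
    ‖cut ξ f - cut η f‖ ^ 2 = |‖cut ξ f‖ ^ 2 - ‖cut η f‖ ^ 2| := by
  rcases le_total ξ η with h | h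
  · rw [← sub_apply, ← norm_sq_cut_sub _ _ h, abs_of_nonneg (sq_nonneg _)]
  · rw [norm_sub_rev, abs_sub_comm, ← sub_apply, ← norm_sq_cut_sub _ _ h,
      abs_of_nonneg (sq_nonneg _)]

lemma continuous_cut_apply (f : L2I a) : Continuous fun ξ => cut ξ f := by
  rw [continuous_iff_continuousAt]
  intro ξ
  rw [ContinuousAt, tendsto_iff_norm_sub_tendsto_zero]
  have h : Filter.Tendsto (fun η => √|‖cut η f‖ ^ 2 - ‖cut ξ f‖ ^ 2|) (𝓝 ξ) (𝓝 0) := by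
    have h1 : Continuous fun η => √|‖cut η f‖ ^ 2 - ‖cut ξ f‖ ^ 2| :=
      (((continuous_norm_sq_cut f).sub continuous_const).abs).sqrt
    simpa using h1.tendsto ξ
  refine h.congr fun η => ?_
  rw [← norm_sq_cut_sub_abs, Real.sqrt_sq (norm_nonneg _)]

lemma continuous_cut_comp {g : ℝ → L2I a} (hg : Continuous g) :
    Continuous fun ξ => cut ξ (g ξ) := by
  rw [continuous_iff_continuousAt]
  intro ξ
  rw [ContinuousAt, tendsto_iff_norm_sub_tendsto_zero]
  have h : Filter.Tendsto (fun η => ‖g η - g ξ‖ + ‖cut η (g ξ) - cut ξ (g ξ)‖) (𝓝 ξ) (𝓝 0) := by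
    have h1 : Continuous fun η => ‖g η - g ξ‖ + ‖cut η (g ξ) - cut ξ (g ξ)‖ :=
      ((hg.sub continuous_const).norm).add
        (((continuous_cut_apply (g ξ)).sub continuous_const).norm)
    simpa using h1.tendsto ξ
  refine squeeze_zero (fun _ => norm_nonneg _) (fun η => ?_) h
  calc ‖cut η (g η) - cut ξ (g ξ)‖
      = ‖cut η (g η - g ξ) + (cut η (g ξ) - cut ξ (g ξ))‖ := by rw [map_sub]; congr 1; abel
    _ ≤ _ := (norm_add_le _ _).trans (by gcongr; exact norm_cut_le _ _)

lemma norm_cut_op_le (ξ : ℝ) : ‖(cut ξ : L2I a →L[ℂ] L2I a)‖ ≤ 1 :=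
  ContinuousLinearMap.opNorm_le_bound _ zero_le_one fun f => by
    rw [one_mul]; exact norm_cut_le ξ f

lemma continuous_cut_mul_cut {M : ℝ} (hM : 0 ≤ M) {K : L2I a →L[ℂ] L2I a} (hK : LInfBounded M K)
    (hsa : ContinuousLinearMap.adjoint K = K) :
    Continuous fun ξ : ℝ => cut ξ * K * cut ξ := by
  have h1 : ∀ ξ η : ℝ, ‖(cut ξ - cut η) * K‖ ≤ M * √|ξ - η| := by
    have aux : ∀ ξ η : ℝ, ξ ≤ η → ‖(cut ξ - cut η) * K‖ ≤ M * √|ξ - η| := by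
      intro ξ η h
      refine ContinuousLinearMap.opNorm_le_bound _ (by positivity) fun g => ?_
      have := hK.norm_sq_cut_sub_le h g
      apply (pow_le_pow_iff_left₀ (norm_nonneg _) (by positivity) two_ne_zero).1
      rw [mul_pow, mul_pow, Real.sq_sqrt (abs_nonneg _), abs_sub_comm,
        abs_of_nonneg (sub_nonneg.2 h)]
      exact this.trans (le_of_eq (by ring))
    intro ξ η
    rcases le_total ξ η with h | h
    · exact aux ξ η h
    · rw [← neg_sub, neg_mul, norm_neg, abs_sub_comm]; exact aux η ξ h
  have h2 : ∀ ξ η : ℝ, ‖K * (cut ξ - cut η)‖ ≤ M * √|ξ - η| := by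
    intro ξ η
    have : K * (cut ξ - cut η) = ContinuousLinearMap.adjoint ((cut ξ - cut η) * K) := by
      rw [ContinuousLinearMap.mul_def, ContinuousLinearMap.mul_def,
        ContinuousLinearMap.adjoint_comp, hsa, map_sub, adjoint_cut, adjoint_cut]
    rw [this, LinearIsometryEquiv.norm_map]
    exact h1 ξ η
  rw [continuous_iff_continuousAt]
  intro ξ
  rw [ContinuousAt, tendsto_iff_norm_sub_tendsto_zero]
  have h : Filter.Tendsto (fun η => M * √|η - ξ| + M * √|η - ξ|) (𝓝 ξ) (𝓝 0) := by
    have h1 : Continuous fun η => M * √|η - ξ| + M * √|η - ξ| := by fun_prop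
    simpa using h1.tendsto ξ
  refine squeeze_zero (fun _ => norm_nonneg _) (fun η => ?_) h
  have e : cut η * K * cut η - cut ξ * K * cut ξ =
      (cut η - cut ξ) * K * cut η + cut ξ * (K * (cut η - cut ξ)) := by noncomm_ring
  rw [e]
  refine (norm_add_le _ _).trans (add_le_add ?_ ?_)
  · refine (norm_mul_le _ _).trans ?_
    calc _ ≤ (M * √|η - ξ|) * 1 := by gcongr; exacts [h1 _ _, norm_cut_op_le _]
      _ = _ := mul_one _
  · refine (norm_mul_le _ _).trans ?_
    calc _ ≤ 1 * (M * √|η - ξ|) := by gcongr; exacts [norm_cut_op_le _, h2 _ _]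
      _ = _ := one_mul _

lemma Upper.adjoint {T : L2I a →L[ℂ] L2I a} (hT : Upper T) :
    Lower (ContinuousLinearMap.adjoint T) := by
  intro ξ f
  refine ext_inner_right ℂ fun g => ?_
  rw [inner_cut, ContinuousLinearMap.adjoint_inner_left, ContinuousLinearMap.adjoint_inner_left,
    inner_cut, inner_cut, hT]

lemma Lower.adjoint {T : L2I a →L[ℂ] L2I a} (hT : Lower T) :
    Upper (ContinuousLinearMap.adjoint T) := by
  intro ξ f
  refine ext_inner_right ℂ fun g => ?_
  rw [inner_cut, inner_cut, ContinuousLinearMap.adjoint_inner_left,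
    ContinuousLinearMap.adjoint_inner_left, inner_cut, hT]

lemma Lower.mul {S T : L2I a →L[ℂ] L2I a} (hS : Lower S) (hT : Lower T) : Lower (S * T) := by
  intro ξ f
  rw [mul_apply_eq_comp, ← hT, hS]

/-- The rows `g x = (1 - P K P)⁻¹ P κ x`, with `P = cut x`, of the Krein resolvent kernel. -/
lemma exists_resolvent_rows {K : L2I a →L[ℂ] L2I a} {κ : ℝ → L2I a}
    (hκ : Continuous κ) (hsa : ContinuousLinearMap.adjoint K = K) (hK : HasRows K κ)
    (hunit : ∀ ξ : ℝ, IsUnit (1 - cut ξ * K * cut ξ)) :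
    ∃ g : ℝ → L2I a, Continuous g ∧ (∀ ξ, cut ξ (g ξ) = g ξ) ∧
      ∀ ξ, cut ξ ((1 - K) (g ξ) - κ ξ) = 0 := by
  obtain ⟨M, hM0, hM⟩ := exists_norm_bound hκ
  have hcont := continuous_cut_mul_cut hM0 (hK.linfBounded hM) hsa
  let R : ℝ → (L2I a →L[ℂ] L2I a) := fun ξ => Ring.inverse (1 - cut ξ * K * cut ξ)
  have hR : Continuous R := by
    rw [continuous_iff_continuousAt]
    intro ξ
    obtain ⟨u, hu⟩ := hunit ξ
    refine ContinuousAt.comp (g := Ring.inverse) ?_ (continuous_const.sub hcont).continuousAt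
    rw [← hu]
    exact NormedRing.inverse_continuousAt u
  have hg : ∀ ξ, R ξ (cut ξ (κ ξ)) - cut ξ (K (cut ξ (R ξ (cut ξ (κ ξ))))) = cut ξ (κ ξ) := by
    intro ξ
    have := congrArg (fun T => T (cut ξ (κ ξ))) (Ring.mul_inverse_cancel _ (hunit ξ))
    exact this
  have hcut : ∀ ξ, cut ξ (R ξ (cut ξ (κ ξ))) = R ξ (cut ξ (κ ξ)) := by
    intro ξ
    have hgen : ∀ v w : L2I a, v - cut ξ (K (cut ξ v)) = cut ξ w → cut ξ v = v := by
      intro v w h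
      rw [sub_eq_iff_eq_add.1 h, map_add, cut_idem, cut_idem]
    exact hgen _ _ (hg ξ)
  refine ⟨fun ξ => R ξ (cut ξ (κ ξ)), hR.clm_apply (continuous_cut_comp hκ), hcut, fun ξ => ?_⟩
  have h := hg ξ
  rw [hcut] at h
  rw [map_sub, sub_apply, map_sub, one_apply_eq_self, hcut, h, sub_self]

theorem exists_factorization (ha : 0 < a) {K : L2I a →L[ℂ] L2I a} {κ : ℝ → L2I a}
    (hκ : Continuous κ) (hsa : ContinuousLinearMap.adjoint K = K) (hK : HasRows K κ)
    (hunit : ∀ ξ : ℝ, IsUnit (1 - cut ξ * K * cut ξ)) :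
    ∃ A U : L2I a →L[ℂ] L2I a, Upper A ∧ Upper U ∧ A * U = 1 ∧ U * A = 1 ∧
      1 - K = U * ContinuousLinearMap.adjoint U := by
  obtain ⟨M, hM0, hM⟩ := exists_norm_bound hκ
  obtain ⟨g, hg, hgcut, hgeq⟩ := exists_resolvent_rows hκ hsa hK hunit
  obtain ⟨N, hN0, hN⟩ := exists_norm_bound hg
  obtain ⟨X, hX⟩ := exists_hasRows hg
  have hXU : Upper X := by
    intro ξ f
    apply Lp.ext
    filter_upwards [cut_ae ξ (X (cut ξ f)), cut_ae ξ (X f), hX (cut ξ f), hX f] with x h1 h2 h3 h4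
    rw [h1, h2, h3, h4]
    split_ifs with h
    · rw [← hgcut x, inner_cut, inner_cut, cut_cut, max_eq_left h.le]
    · rfl
  have hAU : Upper (1 + X) := (upperSubalgebra a).add_mem (upperSubalgebra a).one_mem hXU
  have hlow : Lower ((1 + X) * (1 - K)) := by
    have hE : (1 + X) * (1 - K) = 1 + (X * (1 - K) - K) := by noncomm_ring
    intro ξ f
    have hzero : cut ξ ((X * (1 - K) - K) (cut ξ f)) = (X * (1 - K) - K) (cut ξ f) := by
      apply Lp.ext
      rw [sub_apply, mul_apply_eq_comp]
      filter_upwards [cut_ae ξ (X ((1 - K) (cut ξ f)) - K (cut ξ f)), hX ((1 - K) (cut ξ f)),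
        hK (cut ξ f), Lp.coeFn_sub (X ((1 - K) (cut ξ f))) (K (cut ξ f))] with x h1 h2 h3 h4
      rw [h1]
      split_ifs with h
      · rfl
      · rw [h4, Pi.sub_apply, h2, h3]
        have hx : ⟪g x, (1 - K) (cut ξ f)⟫_ℂ = ⟪(1 - K) (g x), cut ξ f⟫_ℂ := by
          rw [← ContinuousLinearMap.adjoint_inner_left, map_sub, hsa,
            ← ContinuousLinearMap.star_eq_adjoint, star_one]
        rw [hx, ← inner_sub_left, ← max_eq_right (not_lt.1 h), ← cut_cut, ← inner_cut, hgeq,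
          inner_zero_left]
    rw [hE, add_apply, map_add, hzero, one_apply_eq_self, cut_idem]
  have hadjA : ContinuousLinearMap.adjoint (1 + X) = 1 + ContinuousLinearMap.adjoint X := by
    rw [map_add, ← ContinuousLinearMap.star_eq_adjoint, star_one]
  have hW : Lower ((1 + X) * (1 - K) * ContinuousLinearMap.adjoint (1 + X)) :=
    hlow.mul hAU.adjoint
  have hWsa : ContinuousLinearMap.adjoint
      ((1 + X) * (1 - K) * ContinuousLinearMap.adjoint (1 + X)) =
      (1 + X) * (1 - K) * ContinuousLinearMap.adjoint (1 + X) := by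
    simp only [← ContinuousLinearMap.star_eq_adjoint] at hsa ⊢
    simp only [star_mul, star_star, star_sub, star_one, hsa, mul_assoc]
  have hWU := hW.adjoint
  rw [hWsa] at hWU
  set W := (1 + X) * (1 - K) * ContinuousLinearMap.adjoint (1 + X) with hWdef
  have hW1 : W - 1 = 0 := by
    refine eq_zero_of_commute_cut ha (C := X) (B := X * ((1 - K) * (1 + ContinuousLinearMap.adjoint X))
      - K * (1 + ContinuousLinearMap.adjoint X))
      (((hX.linfBounded hN).mul hN0 _).sub ((hK.linfBounded hM).mul hM0 _))
      (hX.linfBounded hN) ?_ ?_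
    · rw [hWdef, hadjA]; noncomm_ring
    · intro ξ f
      rw [sub_apply, map_sub, ← hWU, hW]; rfl
  obtain ⟨U, hU, hAU1, hUA1⟩ := exists_upper_inverse ha (hX.linfBounded hN) hXU
  refine ⟨1 + X, U, hAU, hU, hAU1, hUA1, ?_⟩
  have hstar : ContinuousLinearMap.adjoint (1 + X) * ContinuousLinearMap.adjoint U = 1 := by
    simp only [← ContinuousLinearMap.star_eq_adjoint]
    rw [← star_mul, hUA1, star_one]
  calc 1 - K = (U * (1 + X)) * (1 - K) *
        (ContinuousLinearMap.adjoint (1 + X) * ContinuousLinearMap.adjoint U) := by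
        rw [hUA1, hstar]; simp
    _ = U * W * ContinuousLinearMap.adjoint U := by rw [hWdef]; noncomm_ring
    _ = _ := by rw [sub_eq_zero.1 hW1, mul_one]

lemma fourier_toLp_ae_eq {f : ℝ → ℂ} (h1 : Integrable f) (h2 : MemLp f 2) :
    (𝓕 (h2.toLp f) : Lp (α := ℝ) ℂ 2 volume) =ᵐ[volume] 𝓕 f := by
  have hc : Continuous (𝓕 f) :=
    VectorFourier.fourierIntegral_continuous Real.continuous_fourierChar
      (by fun_prop) h1
  refine ae_eq_of_integral_contDiff_smul_eq
    ((Lp.memLp _).locallyIntegrable (by norm_num)) hc.locallyIntegrable fun g hg hgc => ?_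
  have hgc' : HasCompactSupport (fun x => (g x : ℂ)) := hgc.comp_left (g := Complex.ofReal) rfl
  let φ : 𝓢(ℝ, ℂ) := hgc'.toSchwartzMap (Complex.ofRealCLM.contDiff.comp hg)
  have hφ : ∀ x, φ x = g x := fun x => rfl
  have key := congrArg (fun T => T φ) (Lp.fourier_toTemperedDistribution_eq (h2.toLp f))
  simp only [TemperedDistribution.fourier_apply, Lp.toTemperedDistribution_apply] at key
  have flip := VectorFourier.integral_fourierIntegral_smul_eq_flip (L := innerₗ ℝ)
    (μ := volume) (ν := volume) Real.continuous_fourierChar (by fun_prop) (φ.integrable (μ := volume)) h1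
  have e1 : ∫ x, (𝓕 φ : 𝓢(ℝ, ℂ)) x • (h2.toLp f : Lp (α := ℝ) ℂ 2 volume) x =
      ∫ x, (𝓕 φ : 𝓢(ℝ, ℂ)) x • f x := by
    apply integral_congr_ae
    filter_upwards [h2.coeFn_toLp] with x hx
    rw [hx]
  rw [e1] at key
  calc ∫ x, g x • (𝓕 (h2.toLp f) : Lp (α := ℝ) ℂ 2 volume) x
      = ∫ x, φ x • (𝓕 (h2.toLp f) : Lp (α := ℝ) ℂ 2 volume) x := by simp [hφ]
    _ = ∫ x, (𝓕 φ : 𝓢(ℝ, ℂ)) x • f x := key.symm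
    _ = ∫ x, φ x • 𝓕 f x := by
      refine Eq.trans ?_ (flip.trans ?_)
      · rfl
      · rw [flip_innerₗ]; rfl
    _ = _ := by simp [hφ]

lemma plancherel {f : ℝ → ℂ} (h1 : Integrable f) (h2 : MemLp f 2) :
    Integrable (fun ω => ‖𝓕 f ω‖ ^ 2) ∧ ∫ ω, ‖𝓕 f ω‖ ^ 2 = ∫ x, ‖f x‖ ^ 2 := by
  have hae := fourier_toLp_ae_eq h1 h2
  have hsq : (fun ω => ‖(𝓕 (h2.toLp f) : Lp (α := ℝ) ℂ 2 volume) ω‖ ^ 2) =ᵐ[volume]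
      fun ω => ‖𝓕 f ω‖ ^ 2 := by
    filter_upwards [hae] with x hx
    rw [hx]
  refine ⟨?_, ?_⟩
  · exact ((memLp_two_iff_integrable_sq_norm (Lp.aestronglyMeasurable _)).1
      (Lp.memLp _)).congr hsq
  · rw [← integral_congr_ae hsq, ← norm_sq_eq_integral, Lp.norm_fourier_eq, norm_sq_eq_integral]
    apply integral_congr_ae
    filter_upwards [h2.coeFn_toLp] with x hx
    rw [hx]

/-- The character `s ↦ exp (2πis)`. -/
noncomputable def chr (s : ℝ) : ℂ := Complex.exp ((2 * Real.pi * s : ℝ) * Complex.I)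

lemma continuous_chr : Continuous chr := by
  unfold chr; fun_prop

@[simp] lemma norm_chr (s : ℝ) : ‖chr s‖ = 1 := Complex.norm_exp_ofReal_mul_I _

lemma star_chr (s : ℝ) : (starRingEnd ℂ) (chr s) = chr (-s) := by
  rw [chr, ← Complex.exp_conj, chr]
  congr 1
  rw [map_mul, Complex.conj_ofReal, Complex.conj_I]
  push_cast
  ring

lemma chr_add (s t : ℝ) : chr (s + t) = chr s * chr t := by
  rw [chr, chr, chr, ← Complex.exp_add]
  congr 1
  push_cast
  ring

lemma norm_chr_sub_one_le (s : ℝ) : ‖chr s - 1‖ ≤ 2 * Real.pi * |s| := by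
  rw [chr, mul_comm]
  refine Real.norm_exp_I_mul_ofReal_sub_one_le.trans ?_
  rw [Real.norm_eq_abs, abs_mul, abs_of_pos (by positivity)]

/-- The Lebesgue measure on the frequency band `(-1/2, 1/2]`. -/
noncomputable abbrev band : Measure ℝ := volume.restrict (Set.Ioc (-1 / 2) (1 / 2))

instance : IsProbabilityMeasure band := ⟨by
  rw [Measure.restrict_apply_univ, Real.volume_Ioc]
  norm_num⟩

lemma integral_band_chr {s : ℝ} (hs : s ≠ 0) :
    ∫ w, chr (w * s) ∂band = (Complex.sin (Real.pi * s)) / (Real.pi * s) := by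
  have hs' : (s : ℂ) ≠ 0 := by exact_mod_cast hs
  have hpi : (Real.pi : ℂ) ≠ 0 := by exact_mod_cast Real.pi_ne_zero
  have hc : (2 * Real.pi * s * Complex.I : ℂ) ≠ 0 := by
    simp [hs', hpi]
  have h := integral_exp_mul_complex (a := -1 / 2) (b := 1 / 2) hc
  rw [intervalIntegral.integral_of_le (by norm_num)] at h
  have e : (fun w : ℝ => chr (w * s)) =
      fun w : ℝ => Complex.exp (2 * Real.pi * s * Complex.I * w) := by
    ext w
    rw [chr]
    congr 1
    push_cast
    ring
  rw [e, h, Complex.sin]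
  have e1 : (2 * Real.pi * s * Complex.I * ((1 / 2 : ℝ) : ℂ)) = Real.pi * s * Complex.I := by
    push_cast; ring
  have e2 : (2 * Real.pi * s * Complex.I * ((-1 / 2 : ℝ) : ℂ)) = -(Real.pi * s) * Complex.I := by
    push_cast; ring
  rw [e1, e2]
  field_simp
  rw [Complex.I_sq]
  ring

lemma memLp_chr (w : ℝ) : MemLp (fun t => chr (w * t)) 2 (vol a) :=
  MemLp.of_bound (continuous_chr.comp (by fun_prop)).aestronglyMeasurable 1
    (.of_forall fun t => by simp)

/-- The exponential `t ↦ exp (2πiwt)` as an element of `L²(0, a)`. -/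
noncomputable def expVec (w : ℝ) : L2I a := (memLp_chr w).toLp _

lemma expVec_ae (w : ℝ) : ∀ᵐ t ∂(vol a), (expVec w : L2I a) t = chr (w * t) :=
  (memLp_chr w).coeFn_toLp

lemma inner_expVec_left (w : ℝ) (f : L2I a) :
    ⟪expVec w, f⟫_ℂ = ∫ t, chr (-(w * t)) * f t ∂(vol a) := by
  rw [L2.inner_def]
  apply integral_congr_ae
  filter_upwards [expVec_ae w] with t ht
  rw [ht, RCLike.inner_apply, star_chr, mul_comm]

lemma inner_expVec_right (w : ℝ) (f : L2I a) :
    ⟪f, expVec w⟫_ℂ = ∫ t, chr (w * t) * (starRingEnd ℂ) (f t) ∂(vol a) := by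
  rw [L2.inner_def]
  apply integral_congr_ae
  filter_upwards [expVec_ae w] with t ht
  rw [ht, RCLike.inner_apply]

lemma continuous_expVec : Continuous (expVec : ℝ → L2I a) := by
  refine continuous_iff_continuousAt.2 fun w₀ => ?_
  rw [ContinuousAt, tendsto_iff_norm_sub_tendsto_zero]
  set c : ℝ := (measureUnivNNReal (vol a)) ^ ((2 : ℝ≥0∞).toReal)⁻¹
  have hlim : Filter.Tendsto (fun w => c * (2 * Real.pi * (|w - w₀| * |a|))) (𝓝 w₀) (𝓝 0) := by
    have : Continuous fun w => c * (2 * Real.pi * (|w - w₀| * |a|)) := by fun_prop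
    simpa using this.tendsto w₀
  refine squeeze_zero (fun _ => norm_nonneg _) (fun w => ?_) hlim
  refine Lp.norm_le_of_ae_bound (by positivity) ?_
  filter_upwards [Lp.coeFn_sub (expVec w : L2I a) (expVec w₀), expVec_ae w, expVec_ae w₀,
    ae_restrict_mem measurableSet_Ioo] with t h h1 h2 ht
  rw [h, Pi.sub_apply, h1, h2]
  have e : chr (w * t) - chr (w₀ * t) = chr (w₀ * t) * (chr ((w - w₀) * t) - 1) := by
    rw [mul_sub, ← chr_add, mul_one]
    congr 2
    ring
  rw [e, norm_mul, norm_chr, one_mul]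
  refine (norm_chr_sub_one_le _).trans ?_
  rw [abs_mul]
  gcongr
  · exact ht.1.le
  · exact ht.2.le

/-- The row `t ↦ sin π(x - t) / π(x - t)` of the sine kernel, as an element of `L²(0, a)`. -/
noncomputable def sincRow (x : ℝ) : L2I a := ∫ w, chr (-(w * x)) • (expVec w : L2I a) ∂band

lemma integrable_band {E : Type*} [NormedAddCommGroup E] {f : ℝ → E} (hf : Continuous f) :
    Integrable f band :=
  (hf.integrableOn_Icc (a := -1 / 2) (b := 1 / 2)).mono_set Set.Ioc_subset_Icc_self

lemma continuous_sincRow : Continuous (sincRow : ℝ → L2I a) := by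
  have h : Continuous (Function.uncurry fun x w : ℝ => chr (-(w * x)) • (expVec w : L2I a)) :=
    (continuous_chr.comp (by fun_prop)).smul (continuous_expVec.comp continuous_snd)
  have := intervalIntegral.continuous_parametric_intervalIntegral_of_continuous'
    (μ := volume) h (-1 / 2) (1 / 2)
  simp only [intervalIntegral.integral_of_le (by norm_num : (-1 / 2 : ℝ) ≤ 1 / 2)] at this
  exact this

lemma inner_sincRow (x : ℝ) (f : L2I a) :
    ⟪sincRow x, f⟫_ℂ = ∫ w, chr (w * x) * ⟪expVec w, f⟫_ℂ ∂band := by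
  have hc : Continuous fun w : ℝ => chr (-(w * x)) • (expVec w : L2I a) :=
    (continuous_chr.comp (by fun_prop)).smul continuous_expVec
  rw [← inner_conj_symm, sincRow, ← integral_inner (integrable_band hc), ← integral_conj]
  congr 1
  ext w
  rw [inner_conj_symm, inner_smul_left, star_chr, neg_neg]

lemma integrable_mul_prod {μ ν : Measure ℝ} [SFinite μ] [SFinite ν] {u v : ℝ → ℂ}
    (hu : Integrable u μ) (hv : Integrable v ν) {h : ℝ × ℝ → ℝ} (hh : Continuous h) :
    Integrable (fun p : ℝ × ℝ => chr (h p) * (u p.1 * v p.2)) (μ.prod ν) :=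
  (hu.mul_prod hv).bdd_mul (c := 1) (continuous_chr.comp hh).aestronglyMeasurable
    (.of_forall fun p => by simp)

lemma integrable_coe (f : L2I a) : Integrable f (vol a) :=
  (Lp.memLp f).integrable (by norm_num)

lemma inner_sincRow_eq_integral (x : ℝ) (f : L2I a) :
    ⟪sincRow x, f⟫_ℂ = (1 / (Real.pi : ℂ)) * ∫ t in Set.Ioo (0 : ℝ) a,
      (Complex.sin ((Real.pi : ℂ) * ((x : ℂ) - (t : ℂ))) / ((x : ℂ) - (t : ℂ))) * f t := by
  have hI : Integrable (Function.uncurry fun w t : ℝ => chr (w * (x - t)) * (1 * f t))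
      (band.prod (vol a)) :=
    integrable_mul_prod (integrable_const 1) (integrable_coe f)
      (h := fun p => p.1 * (x - p.2)) (by fun_prop)
  rw [inner_sincRow]
  calc ∫ w, chr (w * x) * ⟪expVec w, f⟫_ℂ ∂band
      = ∫ w, ∫ t, chr (w * (x - t)) * (1 * f t) ∂(vol a) ∂band := by
        congr 1
        ext w
        rw [inner_expVec_left, ← integral_const_mul]
        congr 1
        ext t
        rw [one_mul, ← mul_assoc, ← chr_add]
        congr 2
        ring
    _ = ∫ t, ∫ w, chr (w * (x - t)) * (1 * f t) ∂band ∂(vol a) := integral_integral_swap hI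
    _ = _ := by
        rw [← integral_const_mul]
        apply integral_congr_ae
        have hx : ∀ᵐ t ∂(vol a), t ≠ x :=
          ae_restrict_of_ae (compl_mem_ae_iff.2 (measure_singleton x))
        filter_upwards [hx] with t ht
        rw [integral_mul_const, integral_band_chr (sub_ne_zero.2 ht.symm)]
        push_cast
        rw [one_mul, ← mul_assoc]
        congr 1
        rw [div_mul_div_comm, one_mul]

lemma inner_apply_of_hasRows {K : L2I a →L[ℂ] L2I a} (hK : HasRows K sincRow) (f g : L2I a) :
    ⟪g, K f⟫_ℂ = ∫ w, ⟪g, expVec w⟫_ℂ * ⟪expVec w, f⟫_ℂ ∂band := by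
  have hc : Continuous fun w : ℝ => ⟪(expVec w : L2I a), f⟫_ℂ :=
    continuous_expVec.inner continuous_const
  have hg : Integrable (fun x => (starRingEnd ℂ) (g x)) (vol a) :=
    (Complex.conjLIE.toContinuousLinearEquiv.integrable_comp_iff).2 (integrable_coe g)
  have hI : Integrable (Function.uncurry fun x w : ℝ =>
      chr (w * x) * ((starRingEnd ℂ) (g x) * ⟪(expVec w : L2I a), f⟫_ℂ)) ((vol a).prod band) :=
    integrable_mul_prod hg (integrable_band hc) (h := fun p => p.2 * p.1) (by fun_prop)
  calc ⟪g, K f⟫_ℂ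
      = ∫ x, ∫ w, chr (w * x) * ((starRingEnd ℂ) (g x) * ⟪(expVec w : L2I a), f⟫_ℂ) ∂band
          ∂(vol a) := by
        rw [L2.inner_def]
        apply integral_congr_ae
        filter_upwards [hK f] with x hx
        rw [hx, inner_sincRow, RCLike.inner_apply, ← integral_mul_const]
        congr 1
        ext w
        ring
    _ = ∫ w, ∫ x, chr (w * x) * ((starRingEnd ℂ) (g x) * ⟪(expVec w : L2I a), f⟫_ℂ) ∂(vol a)
          ∂band := integral_integral_swap hI
    _ = _ := by
        congr 1
        ext w
        rw [inner_expVec_right, ← integral_mul_const]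
        congr 1
        ext x
        ring

lemma adjoint_eq_of_hasRows {K : L2I a →L[ℂ] L2I a} (hK : HasRows K sincRow) :
    ContinuousLinearMap.adjoint K = K := by
  symm
  rw [ContinuousLinearMap.eq_adjoint_iff]
  intro f g
  rw [← inner_conj_symm, inner_apply_of_hasRows hK, inner_apply_of_hasRows hK, ← integral_conj]
  congr 1
  ext w
  rw [map_mul, inner_conj_symm, inner_conj_symm, mul_comm]

lemma isCompactOperator_of_hasRows {K : L2I a →L[ℂ] L2I a} (hK : HasRows K sincRow) :
    IsCompactOperator K := by
  let R : ℝ → L2I a →L[ℂ] L2I a := fun w =>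
    ContinuousLinearMap.smulRightL ℂ (L2I a) (L2I a) (innerSL ℂ (expVec w)) (expVec w)
  have hR : Continuous R :=
    ((ContinuousLinearMap.smulRightL ℂ (L2I a) (L2I a)).continuous.comp
      ((innerSL ℂ).continuous.comp continuous_expVec)).clm_apply continuous_expVec
  have hRK : K = ∫ w, R w ∂band := by
    ext1 f
    refine ext_inner_left ℂ fun g => ?_
    have hRf : Continuous fun w => R w f := by fun_prop
    rw [ContinuousLinearMap.integral_apply (integrable_band hR),
      ← integral_inner (integrable_band hRf), inner_apply_of_hasRows hK]
    congr 1
    ext w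
    simp [R, inner_smul_right, mul_comm]
  rw [hRK]
  have hcl : IsClosed {T : L2I a →L[ℂ] L2I a | IsCompactOperator T} :=
    isClosed_setOfPred_isCompactOperator
  have hcv : Convex ℝ {T : L2I a →L[ℂ] L2I a | IsCompactOperator T} :=
    ((compactOperator (RingHom.id ℂ) (L2I a) (L2I a)).restrictScalars ℝ).convex
  refine hcv.integral_mem hcl (.of_forall fun w => ?_) (integrable_band hR)
  have : IsCompactOperator (innerSL ℂ (expVec w : L2I a)) :=
    isCompactOperator_of_locallyCompactSpace_dom _
  exact this.clm_comp (ContinuousLinearMap.toSpanSingleton ℂ (expVec w : L2I a))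

lemma fourier_indicator (f : L2I a) (w : ℝ) :
    𝓕 ((Set.Ioo 0 a).indicator f) w = ⟪expVec w, f⟫_ℂ := by
  rw [Real.fourier_real_eq_integral_exp_smul, inner_expVec_left,
    ← integral_indicator measurableSet_Ioo]
  congr 1
  ext t
  by_cases ht : t ∈ Set.Ioo 0 a
  · rw [Set.indicator_of_mem ht, Set.indicator_of_mem ht, chr, smul_eq_mul]
    congr 3
    push_cast
    ring
  · rw [Set.indicator_of_notMem ht, Set.indicator_of_notMem ht, smul_zero]

lemma parseval (f : L2I a) : Integrable (fun w => ‖⟪(expVec w : L2I a), f⟫_ℂ‖ ^ 2) ∧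
    ∫ w, ‖⟪(expVec w : L2I a), f⟫_ℂ‖ ^ 2 = ‖f‖ ^ 2 := by
  have h := plancherel ((integrable_indicator_iff measurableSet_Ioo).2 (integrable_coe f))
    ((memLp_indicator_iff_restrict measurableSet_Ioo).2 (Lp.memLp f))
  simp only [fourier_indicator] at h
  refine ⟨h.1, h.2.trans ?_⟩
  rw [norm_sq_eq_integral, ← integral_indicator measurableSet_Ioo]
  congr 1
  ext t
  by_cases ht : t ∈ Set.Ioo 0 a
  · rw [Set.indicator_of_mem ht, Set.indicator_of_mem ht]
  · rw [Set.indicator_of_notMem ht, Set.indicator_of_notMem ht]; simp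

lemma eq_zero_of_inner_expVec (f : L2I a) (h : ∀ w : ℝ, ⟪(expVec w : L2I a), f⟫_ℂ = 0) :
    f = 0 := by
  have h2 := (parseval f).2
  simp only [h] at h2
  simpa using h2.symm

/-- The Fourier–Laplace transform of `f`. -/
noncomputable def entireTransform (f : L2I a) (z : ℂ) : ℂ :=
  ∫ t, Complex.exp (-(2 * Real.pi * Complex.I * t) * z) * f t ∂(vol a)

lemma entireTransform_ofReal (f : L2I a) (w : ℝ) :
    entireTransform f w = ⟪(expVec w : L2I a), f⟫_ℂ := by
  rw [inner_expVec_left, entireTransform]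
  congr 1
  ext t
  rw [chr]
  congr 2
  push_cast
  ring

lemma differentiable_entireTransform (f : L2I a) : Differentiable ℂ (entireTransform f) := by
  intro z₀
  have hf : Integrable f (vol a) := integrable_coe f
  set C : ℝ := Real.exp (2 * Real.pi * |a| * (‖z₀‖ + 1))
  have hexp : ∀ t ∈ Set.Ioo 0 a, ∀ z ∈ Metric.ball z₀ 1,
      ‖Complex.exp (-(2 * Real.pi * Complex.I * t) * z)‖ ≤ C := by
    intro t ht z hz
    rw [Complex.norm_exp]
    refine Real.exp_le_exp.2 ((Complex.re_le_norm _).trans ?_)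
    have hz' : ‖z‖ ≤ ‖z₀‖ + 1 := by
      have := norm_le_norm_add_norm_sub' z z₀
      have := mem_ball_iff_norm.1 hz
      linarith
    have ht' : |t| ≤ |a| := abs_le_abs_of_nonneg ht.1.le ht.2.le
    rw [norm_mul, norm_neg, norm_mul, norm_mul, norm_mul]
    simp only [Complex.norm_ofNat, Complex.norm_real, Complex.norm_I, Real.norm_eq_abs,
      abs_of_pos Real.pi_pos, mul_one]
    gcongr
  have hcoef : ∀ t ∈ Set.Ioo 0 a, ‖-(2 * Real.pi * Complex.I * t : ℂ)‖ ≤ 2 * Real.pi * |a| := by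
    intro t ht
    have ht' : |t| ≤ |a| := abs_le_abs_of_nonneg ht.1.le ht.2.le
    rw [norm_neg, norm_mul, norm_mul, norm_mul]
    simp only [Complex.norm_ofNat, Complex.norm_real, Complex.norm_I, Real.norm_eq_abs,
      abs_of_pos Real.pi_pos, mul_one]
    gcongr
  have hmeas : ∀ z : ℂ, AEStronglyMeasurable
      (fun t : ℝ => Complex.exp (-(2 * Real.pi * Complex.I * t) * z) * f t) (vol a) := fun z =>
    (Continuous.aestronglyMeasurable (by fun_prop)).mul hf.aestronglyMeasurable
  refine (hasDerivAt_integral_of_dominated_loc_of_deriv_le (μ := vol a)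
    (F := fun z t => Complex.exp (-(2 * Real.pi * Complex.I * t) * z) * f t)
    (F' := fun z t => Complex.exp (-(2 * Real.pi * Complex.I * t) * z) *
      (-(2 * Real.pi * Complex.I * t)) * f t)
    (bound := fun t => C * (2 * Real.pi * |a|) * ‖f t‖)
    (Metric.ball_mem_nhds z₀ one_pos) (.of_forall hmeas) ?_ ?_ ?_ ?_ ?_).2.differentiableAt
  · refine hf.bdd_mul (c := C) (Continuous.aestronglyMeasurable (by fun_prop)) ?_
    filter_upwards [ae_restrict_mem measurableSet_Ioo] with t ht
    exact hexp t ht z₀ (Metric.mem_ball_self one_pos)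
  · exact (Continuous.aestronglyMeasurable (by fun_prop)).mul hf.aestronglyMeasurable
  · filter_upwards [ae_restrict_mem measurableSet_Ioo] with t ht z hz
    rw [norm_mul, norm_mul]
    gcongr
    · exact hexp t ht z hz
    · exact hcoef t ht
  · exact hf.norm.const_mul _
  · refine .of_forall fun t z _ => ?_
    have := ((hasDerivAt_id z).const_mul (-(2 * Real.pi * Complex.I * t : ℂ))).cexp
    simpa using this.mul_const (f t)

lemma eq_zero_of_hasRows_apply_eq {K : L2I a →L[ℂ] L2I a} (hK : HasRows K sincRow) {f : L2I a}
    (h : ⟪f, K f⟫_ℂ = ⟪f, f⟫_ℂ) : f = 0 := by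
  set F : ℝ → ℂ := fun w => ⟪(expVec w : L2I a), f⟫_ℂ
  have hFc : Continuous F := continuous_expVec.inner continuous_const
  have hband : ∫ w, ‖F w‖ ^ 2 ∂band = ‖f‖ ^ 2 := by
    rw [inner_apply_of_hasRows hK, inner_self_eq_norm_sq_to_K] at h
    have e : ∀ w : ℝ, ⟪f, expVec w⟫_ℂ * ⟪(expVec w : L2I a), f⟫_ℂ = ((‖F w‖ ^ 2 : ℝ) : ℂ) := by
      intro w
      rw [← inner_conj_symm, ← Complex.normSq_eq_conj_mul_self, Complex.normSq_eq_norm_sq]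
    simp only [e, integral_complex_ofReal, Complex.coe_algebraMap] at h
    exact_mod_cast h
  obtain ⟨hint, hfull⟩ : Integrable (fun w => ‖F w‖ ^ 2) ∧ ∫ w, ‖F w‖ ^ 2 = ‖f‖ ^ 2 := parseval f
  have hout : ∫ w in (Set.Ioc (-1 / 2 : ℝ) (1 / 2))ᶜ, ‖F w‖ ^ 2 = 0 := by
    have := integral_add_compl (s := Set.Ioc (-1 / 2 : ℝ) (1 / 2)) measurableSet_Ioc hint
    exact add_eq_left.1 (this.trans (hfull.trans hband.symm))
  have hout' : (fun w => ‖F w‖ ^ 2) =ᵐ[volume.restrict (Set.Ioc (-1 / 2 : ℝ) (1 / 2))ᶜ] 0 :=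
    (integral_eq_zero_iff_of_nonneg (fun w => by positivity) hint.integrableOn).1 hout
  have hIoi : Set.EqOn F 0 (Set.Ioi (1 / 2)) := by
    refine Measure.eqOn_open_of_ae_eq (μ := volume) ?_ isOpen_Ioi hFc.continuousOn continuousOn_const
    have hsub : Set.Ioi (1 / 2 : ℝ) ⊆ (Set.Ioc (-1 / 2 : ℝ) (1 / 2))ᶜ := fun w hw hw' =>
      absurd hw'.2 (not_le.2 hw)
    filter_upwards [ae_restrict_of_ae_restrict_of_subset hsub hout'] with w hw
    simpa using hw
  have hzero : entireTransform f = 0 := by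
    refine AnalyticOnNhd.eq_of_frequently_eq (z₀ := (1 : ℂ))
      (fun z _ => (differentiable_entireTransform f).analyticAt z)
      (fun z _ => analyticAt_const) ?_
    have htend : Filter.Tendsto (fun w : ℝ => (w : ℂ)) (𝓝[≠] 1) (𝓝[≠] 1) := by
      refine tendsto_nhdsWithin_iff.2 ⟨?_, ?_⟩
      · exact (Complex.continuous_ofReal.tendsto' 1 1 (by simp)).mono_left nhdsWithin_le_nhds
      · filter_upwards [self_mem_nhdsWithin] with w hw
        simpa using hw
    refine htend.frequently (Filter.Eventually.frequently ?_)
    filter_upwards [mem_nhdsWithin_of_mem_nhds (Ioi_mem_nhds (by norm_num : (1 / 2 : ℝ) < 1))]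
      with w hw
    rw [entireTransform_ofReal]
    exact hIoi hw
  refine eq_zero_of_inner_expVec f fun w => ?_
  rw [← entireTransform_ofReal, hzero, Pi.zero_apply]

lemma isUnit_one_sub_cut_of_hasRows {K : L2I a →L[ℂ] L2I a} (hK : HasRows K sincRow) (ξ : ℝ) :
    IsUnit (1 - cut ξ * K * cut ξ) := by
  have hc : IsCompactOperator (cut ξ * K * cut ξ : L2I a →L[ℂ] L2I a) :=
    ((isCompactOperator_of_hasRows hK).clm_comp (cut ξ)).comp_clm (cut ξ)
  rcases hc.hasEigenvalue_or_mem_resolventSet (one_ne_zero (α := ℂ)) with h | h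
  · exfalso
    obtain ⟨f, hf⟩ := h.exists_hasEigenvector
    have hT : cut ξ (K (cut ξ f)) = f := by simpa using hf.apply_eq_smul
    have hcut : cut ξ f = f := by
      rw [← hT]
      exact cut_idem _ _
    refine hf.2 (eq_zero_of_hasRows_apply_eq hK ?_)
    calc ⟪f, K f⟫_ℂ = ⟪f, cut ξ (K (cut ξ f))⟫_ℂ := by rw [← inner_cut, hcut]
      _ = ⟪f, f⟫_ℂ := by rw [hT]
  · simpa [resolventSet] using h

end SineKernel

/- STATEMENT 19: The sine-kernel operator
   (Sf)(x) = f(x) − (1/π)∫₀^a sin(π(x−t))/(x−t) f(t) dt on L²(0,a) admits a triangular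
   factorization: there is a bounded invertible operator S₋ with bounded inverse such
   that S = S₋S₋* and for every ξ ∈ [0,a], Q_ξ S₋ Q_ξ = Q_ξ S₋ and
   Q_ξ S₋⁻¹ Q_ξ = Q_ξ S₋⁻¹, where Q_ξ is multiplication by the indicator of (ξ,a). -/
theorem stmt_19 (a : ℝ) (ha : 0 < a)
    -- S is the sine-kernel operator with γ = −1 on L²(0,a)
    (S : Lp (α := ℝ) ℂ 2 (volume.restrict (Set.Ioo 0 a)) →L[ℂ]
      Lp (α := ℝ) ℂ 2 (volume.restrict (Set.Ioo 0 a)))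
    (hS : ∀ f : Lp (α := ℝ) ℂ 2 (volume.restrict (Set.Ioo 0 a)),
      ∀ᵐ x ∂(volume.restrict (Set.Ioo (0:ℝ) a)),
        S f x = f x - (1 / (Real.pi : ℂ)) * ∫ t in Set.Ioo (0:ℝ) a,
          (Complex.sin ((Real.pi : ℂ) * ((x : ℂ) - (t : ℂ))) / ((x : ℂ) - (t : ℂ))) * f t)
    -- Q ξ is multiplication by the indicator function of (ξ, a)
    (Q : ℝ → (Lp (α := ℝ) ℂ 2 (volume.restrict (Set.Ioo 0 a)) →L[ℂ]
      Lp (α := ℝ) ℂ 2 (volume.restrict (Set.Ioo 0 a))))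
    (hQ : ∀ ξ ∈ Set.Icc (0:ℝ) a, ∀ f : Lp (α := ℝ) ℂ 2 (volume.restrict (Set.Ioo 0 a)),
      ∀ᵐ x ∂(volume.restrict (Set.Ioo (0:ℝ) a)),
        (Q ξ) f x = if ξ < x then f x else 0) :
    -- triangular factorization S = S₋ S₋*
    ∃ Sm Sminv : Lp (α := ℝ) ℂ 2 (volume.restrict (Set.Ioo 0 a)) →L[ℂ]
        Lp (α := ℝ) ℂ 2 (volume.restrict (Set.Ioo 0 a)),
      Sm.comp Sminv = ContinuousLinearMap.id ℂ _ ∧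
      Sminv.comp Sm = ContinuousLinearMap.id ℂ _ ∧
      S = Sm.comp (ContinuousLinearMap.adjoint Sm) ∧
      -- lower triangularity of S₋ and of S₋⁻¹
      (∀ ξ ∈ Set.Icc (0:ℝ) a,
        ((Q ξ).comp Sm).comp (Q ξ) = (Q ξ).comp Sm ∧
        ((Q ξ).comp Sminv).comp (Q ξ) = (Q ξ).comp Sminv) := by
  have hK : SineKernel.HasRows (1 - S) SineKernel.sincRow := by
    intro f
    filter_upwards [hS f, Lp.coeFn_sub f (S f)] with x h1 h2
    rw [SineKernel.inner_sincRow_eq_integral]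
    refine h2.trans ?_
    rw [Pi.sub_apply, h1, sub_sub_cancel]
  obtain ⟨A, U, hA, hU, hAU, hUA, hfac⟩ := SineKernel.exists_factorization ha
    SineKernel.continuous_sincRow (SineKernel.adjoint_eq_of_hasRows hK) hK
    (SineKernel.isUnit_one_sub_cut_of_hasRows hK)
  rw [sub_sub_cancel] at hfac
  refine ⟨U, A, hUA, hAU, hfac, fun ξ hξ => ?_⟩
  have hQξ : Q ξ = SineKernel.cut ξ := by
    ext1 f
    apply Lp.ext
    filter_upwards [hQ ξ hξ f, SineKernel.cut_ae ξ f] with x h1 h2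
    rw [h1, h2]
  rw [hQξ]
  exact ⟨ContinuousLinearMap.ext (hU ξ), ContinuousLinearMap.ext (hA ξ)⟩
end
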